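/- Let p be an odd prime, let q be an odd prime power, and let f ∈ 𝔽_q[T] be a squarefree polynomial of odd degree. For n ≥ 0 let R_n = 𝔽_{q^{p^n}}[T][x]/(x² − f) and e_n = v_p(#Cl(R_n)). Then liminf_{n→∞} e_n/n ≥ dim_{𝔽_p}( Cl(R_0) / p·Cl(R_0) ); that is, the Iwasawa λ-invariant of the constant ℤ_p-extension of F = 𝔽_q(T)(√f) is at least the p-rank of the class group of F. -/

import Mathlib

open Polynomial

set_option maxHeartbeats 1000000
set_option synthInstance.maxHeartbeats 400000

section
open Polynomial

set_option linter.all false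
set_option linter.unusedSimpArgs false
set_option linter.unusedVariables false

namespace HypE

section LogDeriv

/-- `LD q a` : `a` is the logarithmic derivative of `q` times the variable. -/
def LD {Fo : Type*} [Field Fo] (q : PowerSeries Fo) (a : ℕ → Fo) : Prop :=
  ∀ d : ℕ, (d : Fo) * PowerSeries.coeff d q =
    ∑ ij ∈ Finset.HasAntidiagonal.antidiagonal d, (if ij.1 = 0 then 0 else a ij.1) * PowerSeries.coeff ij.2 q

variable {Fo : Type*} [Field Fo]

lemma LD_iff (q : PowerSeries Fo) (a : ℕ → Fo) :
    LD q a ↔ PowerSeries.X * PowerSeries.derivative Fo q =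
      PowerSeries.mk (fun m => if m = 0 then 0 else a m) * q := by
  rw [PowerSeries.ext_iff]
  refine forall_congr' fun d => ?_
  rw [PowerSeries.coeff_mul (φ := PowerSeries.mk _)]
  cases d with
  | zero => simp
  | succ d =>
    rw [PowerSeries.coeff_succ_X_mul]
    simp [PowerSeries.coeff_derivative, PowerSeries.coeff_mk, mul_comm]

lemma LD.mul {q₁ q₂ : PowerSeries Fo} {a₁ a₂ : ℕ → Fo} (h₁ : LD q₁ a₁) (h₂ : LD q₂ a₂) :
    LD (q₁ * q₂) (fun m => a₁ m + a₂ m) := by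
  rw [LD_iff] at *
  have e : (PowerSeries.mk (fun m => if m = 0 then (0:Fo) else a₁ m + a₂ m)) =
      PowerSeries.mk (fun m => if m = 0 then (0:Fo) else a₁ m) +
      PowerSeries.mk (fun m => if m = 0 then (0:Fo) else a₂ m) := by
    ext m; simp; split_ifs <;> simp
  rw [e, Derivation.leibniz]
  simp only [smul_eq_mul]
  linear_combination q₂ * h₁ + q₁ * h₂

lemma LD_linear (β : Fo) : LD (1 - PowerSeries.C β * PowerSeries.X) (fun m => - β ^ m) := by
  rw [LD_iff]
  have : PowerSeries.derivative Fo (1 - PowerSeries.C β * PowerSeries.X) = - PowerSeries.C β := by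
    ext n
    simp [PowerSeries.coeff_derivative, PowerSeries.coeff_one, PowerSeries.coeff_X, PowerSeries.coeff_C]
  rw [this, mul_sub, mul_one, ← mul_assoc]
  ext m
  rcases m with _ | _ | m
  · simp
  · simp [PowerSeries.coeff_succ_mul_X, mul_comm]
  · rw [map_sub, PowerSeries.coeff_succ_mul_X]
    simp [PowerSeries.coeff_X]
    ring

lemma LD_one : LD (1 : PowerSeries Fo) (fun _ => 0) := by
  intro d; rcases d with _ | d <;> simp

lemma LD_multiset (s : Multiset Fo) :
    LD ((s.map fun β => 1 - PowerSeries.C β * PowerSeries.X).prod)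
      (fun m => - (s.map fun β => β ^ m).sum) := by
  induction s using Multiset.induction_on with
  | empty => simpa using LD_one
  | cons b s ih =>
    simp only [Multiset.map_cons, Multiset.prod_cons, Multiset.sum_cons]
    have := (LD_linear b).mul ih
    convert this using 2
    ring

lemma LD_unique [CharZero Fo] {q₁ q₂ : PowerSeries Fo} {a₁ a₂ : ℕ → Fo}
    (h₁ : LD q₁ a₁) (h₂ : LD q₂ a₂) (ha : ∀ m, 0 < m → a₁ m = a₂ m)
    (h0 : PowerSeries.coeff 0 q₁ = PowerSeries.coeff 0 q₂) : q₁ = q₂ := by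
  ext d
  induction d using Nat.strong_induction_on with
  | _ d ih =>
    rcases Nat.eq_zero_or_pos d with rfl | hd
    · exact h0
    · have : (d : Fo) ≠ 0 := by exact_mod_cast hd.ne'
      apply mul_left_cancel₀ this
      rw [h₁ d, h₂ d]
      refine Finset.sum_congr rfl fun ij hij => ?_
      rw [Finset.HasAntidiagonal.mem_antidiagonal] at hij
      split_ifs with h
      · simp
      · rw [ha _ (Nat.pos_of_ne_zero h), ih _ (by omega)]

lemma LD_unique_a {q : PowerSeries Fo} {a₁ a₂ : ℕ → Fo}
    (h₁ : LD q a₁) (h₂ : LD q a₂) (h0 : q ≠ 0) : ∀ m, 0 < m → a₁ m = a₂ m := by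
  rw [LD_iff] at *
  rw [h₁] at h₂
  have := mul_right_cancel₀ h0 h₂
  intro m hm
  have := congrArg (PowerSeries.coeff m) this
  simpa [hm.ne'] using this

/-- factorisation of a polynomial with constant coefficient one. -/
lemma exists_factor [IsAlgClosed Fo] (P : Fo[X]) (h0 : P.coeff 0 = 1) :
    ∃ s : Multiset Fo, P = (s.map fun β => 1 - C β * X).prod := by
  have hP : P ≠ 0 := by rintro rfl; simp at h0
  have hs := IsAlgClosed.splits P
  have h1 := hs.eq_prod_roots
  refine ⟨P.roots.map (·⁻¹), ?_⟩
  have hr : ∀ r ∈ P.roots, r ≠ 0 := by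
    rintro r hr rfl
    rw [mem_roots hP, IsRoot, ← coeff_zero_eq_eval_zero, h0] at hr
    exact one_ne_zero hr
  have h2 : (P.roots.map fun a => X - C a).prod =
      (P.roots.map fun a => C (-a)).prod * ((P.roots.map (·⁻¹)).map fun β => 1 - C β * X).prod := by
    rw [Multiset.map_map, ← Multiset.prod_map_mul]
    refine congrArg _ (Multiset.map_congr rfl fun r hr' => ?_)
    have := hr r hr'
    simp only [Function.comp]
    rw [mul_sub, ← mul_assoc, ← C_mul]
    simp [this]
    ring
  rw [h2, ← mul_assoc] at h1
  set A := C P.leadingCoeff * (P.roots.map fun a => C (-a)).prod with hA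
  have hA' : ∃ c, A = C c := by
    refine ⟨P.leadingCoeff * (P.roots.map fun a => (-a)).prod, ?_⟩
    rw [hA, C_mul, map_multiset_prod, Multiset.map_map]; rfl
  obtain ⟨c, hc⟩ := hA'
  have h3 : ((P.roots.map (·⁻¹)).map fun β => 1 - C β * X).prod.coeff 0 = 1 := by
    rw [coeff_zero_eq_eval_zero, eval_multiset_prod, Multiset.map_map]
    simp
  have h4 := congrArg (fun p => p.coeff 0) h1
  simp only [hc, coeff_C_mul, h3, h0, mul_one] at h4
  rw [hc, ← h4] at h1
  simpa using h1

lemma coe_prod (s : Multiset Fo) :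
    (((s.map fun β => 1 - C β * X).prod : Fo[X]) : PowerSeries Fo) =
      (s.map fun β => 1 - PowerSeries.C β * PowerSeries.X).prod := by
  induction s using Multiset.induction_on with
  | empty => simp
  | cons b s ih => simp [ih]

lemma coeff_zero_prod (s : Multiset Fo) :
    PowerSeries.coeff 0 (s.map fun β => 1 - PowerSeries.C β * PowerSeries.X).prod = 1 := by
  induction s using Multiset.induction_on with
  | empty => simp
  | cons b s ih => simp at ih; simp [ih]

/-- Passing to the `N`-th powers. -/
lemma pow_transfer [CharZero Fo] [IsAlgClosed Fo] (P : Fo[X]) (h0 : P.coeff 0 = 1) (a : ℕ → Fo)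
    (h : LD (P : PowerSeries Fo) a) :
    ∃ s : Multiset Fo, P = (s.map fun β => 1 - C β * X).prod ∧
    ∀ (N : ℕ) (_ : 0 < N) (q : PowerSeries Fo) (b : ℕ → Fo) (_ : LD q b)
      (_ : PowerSeries.coeff 0 q = 1) (_ : ∀ m, 0 < m → b m = a (N * m)),
      q = (((s.map fun β => 1 - C (β ^ N) * X).prod : Fo[X]) : PowerSeries Fo) := by
  obtain ⟨s, hs⟩ := exists_factor P h0
  refine ⟨s, hs, fun N hN q b hq hq0 hb => ?_⟩
  have h1 : LD (P : PowerSeries Fo) (fun m => - (s.map fun β => β ^ m).sum) := by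
    rw [hs, coe_prod]; exact LD_multiset s
  have hP0 : (P : PowerSeries Fo) ≠ 0 := by
    intro h; rw [Polynomial.coe_eq_zero_iff] at h; simp [h] at h0
  have h2 := LD_unique_a h h1 hP0
  have e : (s.map fun β => 1 - C (β ^ N) * X) = ((s.map (· ^ N)).map fun β => 1 - C β * X) := by
    rw [Multiset.map_map]; rfl
  rw [e, coe_prod]
  refine LD_unique hq (LD_multiset _) (fun m hm => ?_) (by rw [hq0, coeff_zero_prod])
  rw [hb m hm, h2 _ (Nat.mul_pos hN hm), Multiset.map_map]
  simp [pow_mul]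

end LogDeriv
end HypE
end

section
open Polynomial


namespace HypE

section Padic
variable {p : ℕ} [hp : Fact p.Prime]

lemma norm_natCast_le_one (m : ℕ) : ‖(m : PadicAlgCl p)‖ ≤ 1 := by
  have := PadicAlgCl.norm_extends p (m : ℚ_[p])
  rw [map_natCast] at this
  rw [this]
  exact_mod_cast Padic.norm_int_le_one (p := p) (m : ℤ)

lemma norm_intCast_le_one (m : ℤ) : ‖(m : PadicAlgCl p)‖ ≤ 1 := by
  have := PadicAlgCl.norm_extends p (m : ℚ_[p])
  rw [map_intCast] at this
  rw [this]
  exact Padic.norm_int_le_one m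

lemma norm_p : ‖(p : PadicAlgCl p)‖ = (p : ℝ)⁻¹ := by
  have := PadicAlgCl.norm_extends p (p : ℚ_[p])
  rw [map_natCast] at this
  rw [this, Padic.norm_p]

lemma norm_step (hp2 : 3 ≤ p) (y : PadicAlgCl p) (hy : ‖y‖ ≤ (p : ℝ)⁻¹) :
    ‖(1 + y) ^ p - 1‖ = (p : ℝ)⁻¹ * ‖y‖ := by
  have hp0 : (0:ℝ) < p := by exact_mod_cast hp.out.pos
  have hp1 : (p:ℝ)⁻¹ < 1 := inv_lt_one_of_one_lt₀ (by exact_mod_cast hp.out.one_lt)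
  by_cases hy0 : y = 0
  · simp [hy0]
  have hypos : 0 < ‖y‖ := norm_pos_iff.mpr hy0
  have na := PadicAlgCl.isNonarchimedean p
  obtain ⟨p', rfl⟩ : ∃ p', p = p' + 2 := ⟨p - 2, by omega⟩
  have e : (1 + y) ^ (p'+2) - 1 = ((p'+2 : ℕ) : PadicAlgCl (p'+2)) * y +
      ∑ i ∈ Finset.range (p' + 1), y ^ (i+2) * ((p'+2).choose (i+2) : PadicAlgCl (p'+2)) := by
    rw [add_comm 1 y, add_pow, Finset.sum_range_succ', Finset.sum_range_succ']
    simp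
    ring
  have hs : ‖∑ i ∈ Finset.range (p' + 1), y ^ (i+2) * ((p'+2).choose (i+2) : PadicAlgCl (p'+2))‖
      < ‖((p'+2 : ℕ) : PadicAlgCl (p'+2)) * y‖ := by
    obtain ⟨i, hi, h⟩ := na.finset_image_add_of_nonempty (fun i => y ^ (i+2) * ((p'+2).choose (i+2) : PadicAlgCl (p'+2)))
      (t := Finset.range (p'+1)) ⟨0, by simp⟩
    refine h.trans_lt ?_
    rw [Finset.mem_range] at hi
    rw [norm_mul, norm_mul, norm_pow, norm_p]
    by_cases hi' : i = p'
    · subst hi'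
      simp only [Nat.choose_self, Nat.cast_one, norm_one, mul_one]
      have : ‖y‖ ^ (i+2) = ‖y‖^(i-1) * (‖y‖ ^ 2 * ‖y‖) := by
        rw [← pow_succ, ← pow_add]; congr 1; omega
      rw [this]
      have h1 : ‖y‖^(i-1) ≤ 1 := pow_le_one₀ hypos.le (hy.trans hp1.le)
      have h2 : ‖y‖^2 < ((i+2:ℕ):ℝ)⁻¹ := by nlinarith
      have h3 : ‖y‖ ^ 2 * ‖y‖ < ((i+2:ℕ):ℝ)⁻¹ * ‖y‖ := by nlinarith
      have h4 : 0 ≤ ‖y‖ ^ 2 * ‖y‖ := by positivity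
      nlinarith
    · obtain ⟨c, hc⟩ := hp.out.dvd_choose_self (k := i+2) (by omega) (by omega)
      rw [hc, Nat.cast_mul, norm_mul, norm_p]
      have h1 : ‖(c : PadicAlgCl (p'+2))‖ ≤ 1 := norm_natCast_le_one c
      have h2 : ‖y‖ ^ (i+2) < ‖y‖ := by
        have : ‖y‖ ^ (i+2) = ‖y‖^(i) * ‖y‖ * ‖y‖ := by ring
        rw [this]
        have : ‖y‖^i ≤ 1 := pow_le_one₀ hypos.le (hy.trans hp1.le)
        have h5 : ‖y‖ ^ i * ‖y‖ < 1 := by nlinarith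
        nlinarith
      have h6 : 0 < ((p'+2:ℕ):ℝ)⁻¹ := by positivity
      have h7 : ((p'+2:ℕ):ℝ)⁻¹ * ‖(c : PadicAlgCl (p'+2))‖ ≤ ((p'+2:ℕ):ℝ)⁻¹ := by nlinarith
      calc _ ≤ ‖y‖ ^ (i+2) * ((p'+2:ℕ):ℝ)⁻¹ := by gcongr
        _ < ‖y‖ * ((p'+2:ℕ):ℝ)⁻¹ := by gcongr
        _ = _ := mul_comm _ _
  have hmax : ‖((p'+2 : ℕ) : PadicAlgCl (p'+2)) * y +
      ∑ i ∈ Finset.range (p' + 1), y ^ (i+2) * ((p'+2).choose (i+2) : PadicAlgCl (p'+2))‖ =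
      ‖((p'+2 : ℕ) : PadicAlgCl (p'+2)) * y‖ := by
    apply le_antisymm
    · exact (na _ _).trans (max_le le_rfl hs.le)
    · set A := ((p'+2 : ℕ) : PadicAlgCl (p'+2)) * y
      set S := ∑ i ∈ Finset.range (p' + 1), y ^ (i+2) * ((p'+2).choose (i+2) : PadicAlgCl (p'+2))
      by_contra hcon
      push Not at hcon
      have := na (A + S) (-S)
      rw [add_neg_cancel_right, norm_neg] at this
      exact absurd this (not_le.mpr (max_lt hcon hs))
  rw [e, hmax, norm_mul, norm_p]

lemma norm_pow_bound (hp2 : 3 ≤ p) (α : PadicAlgCl p) (hne : ∀ n : ℕ, α ^ p ^ n ≠ 1) :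
    ∃ c : ℝ, 0 < c ∧ ∀ n : ℕ, c * ((p : ℝ)⁻¹) ^ n ≤ ‖1 - α ^ p ^ n‖ := by
  have hp0 : (0:ℝ) < p := by exact_mod_cast hp.out.pos
  have hp1 : (p:ℝ)⁻¹ < 1 := inv_lt_one_of_one_lt₀ (by exact_mod_cast hp.out.one_lt)
  have hpos : ∀ n, 0 < ‖1 - α ^ p ^ n‖ := fun n => norm_pos_iff.mpr (sub_ne_zero.mpr (hne n).symm)
  have step : ∀ n, ‖1 - α ^ p ^ n‖ ≤ (p:ℝ)⁻¹ → ‖1 - α ^ p ^ (n+1)‖ = (p:ℝ)⁻¹ * ‖1 - α ^ p ^ n‖ := by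
    intro n hn
    have := norm_step hp2 (α ^ p ^ n - 1) (by rwa [norm_sub_rev])
    rw [norm_sub_rev, norm_sub_rev 1 (α ^ p ^ n), ← this, pow_succ, pow_mul]
    congr 2; ring
  by_cases h : ∃ n, ‖1 - α ^ p ^ n‖ ≤ (p:ℝ)⁻¹
  · -- first index
    classical
    set n0 := Nat.find h
    have hn0 := Nat.find_spec h
    have hlt : ∀ n < n0, (p:ℝ)⁻¹ < ‖1 - α ^ p ^ n‖ := fun n hn => by
      have := Nat.find_min h hn; push Not at this; exact this
    have hge : ∀ k, ‖1 - α ^ p ^ (n0+k)‖ = ((p:ℝ)⁻¹)^k * ‖1 - α ^ p ^ n0‖ := by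
      intro k
      induction k with
      | zero => simp
      | succ k ih =>
        rw [← add_assoc, step, ih]; · ring
        rw [ih]
        calc _ ≤ 1 * ‖1 - α ^ p ^ n0‖ := by
              gcongr; exact pow_le_one₀ (by positivity) hp1.le
          _ ≤ _ := by rw [one_mul]; exact hn0
    refine ⟨min (p:ℝ)⁻¹ ‖1 - α ^ p ^ n0‖, lt_min (by positivity) (hpos _), fun n => ?_⟩
    rcases lt_or_ge n n0 with hn | hn
    · calc _ ≤ (p:ℝ)⁻¹ * 1 := by
            gcongr
            · exact min_le_left _ _
            · exact pow_le_one₀ (by positivity) hp1.le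
        _ ≤ _ := by rw [mul_one]; exact (hlt n hn).le
    · obtain ⟨k, rfl⟩ := Nat.exists_eq_add_of_le hn
      rw [hge, mul_comm]
      exact mul_le_mul (pow_le_pow_of_le_one (by positivity) hp1.le (by omega))
        (min_le_right _ _) (le_min (by positivity) (hpos _).le) (by positivity)
  · push Not at h
    refine ⟨(p:ℝ)⁻¹, by positivity, fun n => ?_⟩
    calc _ ≤ (p:ℝ)⁻¹ * 1 := by
            gcongr
            exact pow_le_one₀ (by positivity) hp1.le
        _ ≤ _ := by rw [mul_one]; exact (h n).le

lemma factorization_bound (hp2 : 3 ≤ p) (s : Multiset (PadicAlgCl p)) (h : ℕ → ℕ)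
    (h0 : ∀ n, h n ≠ 0)
    (hh : ∀ n, (h n : PadicAlgCl p) = (s.map fun β => 1 - β ^ p ^ n).prod) :
    ∃ B D : ℕ, ∀ n, (h n).factorization p ≤ B + D * n := by
  have hp0 : (0:ℝ) < p := by exact_mod_cast hp.out.pos
  have hp1 : (1:ℝ) < p := by exact_mod_cast hp.out.one_lt
  have hne : ∀ β ∈ s, ∀ n : ℕ, β ^ p ^ n ≠ 1 := by
    intro β hβ n h1
    have : (s.map fun β => 1 - β ^ p ^ n).prod = 0 := by
      apply Multiset.prod_eq_zero
      rw [Multiset.mem_map]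
      exact ⟨β, hβ, by rw [h1, sub_self]⟩
    rw [← hh n] at this
    exact h0 n (by exact_mod_cast this)
  have key : ∀ t : Multiset (PadicAlgCl p), (∀ β ∈ t, ∀ n : ℕ, β ^ p ^ n ≠ 1) →
      ∃ c : ℝ, 0 < c ∧ ∀ n : ℕ, c * (((p : ℝ)⁻¹) ^ n) ^ t.card ≤ ‖(t.map fun β => 1 - β ^ p ^ n).prod‖ := by
    intro t
    induction t using Multiset.induction_on with
    | empty => intro _; exact ⟨1, one_pos, by simp⟩
    | cons b t ih =>
      intro ht
      obtain ⟨c, hc, h1⟩ := ih (fun β hβ => ht β (Multiset.mem_cons_of_mem hβ))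
      obtain ⟨c', hc', h2⟩ := norm_pow_bound hp2 b (ht b (Multiset.mem_cons_self b t))
      refine ⟨c' * c, by positivity, fun n => ?_⟩
      rw [Multiset.map_cons, Multiset.prod_cons, norm_mul, Multiset.card_cons, pow_succ]
      calc _ = (c' * (p:ℝ)⁻¹ ^ n) * (c * ((p:ℝ)⁻¹ ^ n) ^ t.card) := by ring
        _ ≤ _ := by gcongr; exact h2 n; exact h1 n
  obtain ⟨c, hc, h1⟩ := key s hne
  obtain ⟨B, hB⟩ := pow_unbounded_of_one_lt (c⁻¹) hp1
  refine ⟨B, s.card, fun n => ?_⟩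
  set e := (h n).factorization p
  have h2 := h1 n
  rw [← hh n] at h2
  have h3 : ‖(h n : PadicAlgCl p)‖ ≤ ((p:ℝ)⁻¹) ^ e := by
    obtain ⟨m, hm⟩ := Nat.ordProj_dvd (h n) p
    have h4 : (h n : PadicAlgCl p) = (p : PadicAlgCl p) ^ e * m := by
      conv_lhs => rw [hm]
      push_cast; rfl
    rw [h4, norm_mul, norm_pow, norm_p]
    calc _ ≤ ((p:ℝ)⁻¹) ^ e * 1 := by gcongr; exact norm_natCast_le_one m
      _ = _ := mul_one _
  have h5 := h2.trans h3
  have h6 : (p:ℝ)^e ≤ (p:ℝ)^(B + s.card * n) := by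
    rw [← pow_mul, inv_pow, inv_pow] at h5
    have : (p:ℝ)^e ≤ c⁻¹ * (p:ℝ)^(n * s.card) := by
      have h7 := inv_anti₀ (by positivity) h5
      rw [inv_inv, mul_inv, inv_inv] at h7
      exact h7
    calc _ ≤ _ := this
      _ ≤ (p:ℝ)^B * (p:ℝ)^(n * s.card) := by gcongr
      _ = _ := by rw [pow_add, mul_comm n]
  exact (pow_le_pow_iff_right₀ hp1).mp h6

end Padic
end HypE
end

section
open Polynomial


namespace HypE

/-- `R` is `F[T][x]/(x²-f)`, abstractly. -/
structure HR {F : Type*} [Field F] (f : F[X]) {R : Type*} [CommRing R] [Algebra F[X] R]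
    (x : R) : Prop where
  sq : x ^ 2 = algebraMap F[X] R f
  ex : ∀ z : R, ∃ ab : F[X] × F[X], z = algebraMap F[X] R ab.1 + algebraMap F[X] R ab.2 * x
  inj : ∀ a b : F[X], algebraMap F[X] R a + algebraMap F[X] R b * x = 0 → a = 0 ∧ b = 0
  sqf : Squarefree f
  odd : Odd f.natDegree
  two : (2 : F) ≠ 0

namespace HR
variable {F : Type*} [Field F] {f : F[X]} {R : Type*} [CommRing R] [Algebra F[X] R] {x : R}
  (H : HR f x)

local notation "am" => algebraMap F[X] R

/-- first coordinate -/
noncomputable def ca (z : R) : F[X] := (H.ex z).choose.1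
/-- second coordinate -/
noncomputable def cb (z : R) : F[X] := (H.ex z).choose.2

include H in
lemma f_ne : f ≠ 0 := by
  rintro h; have := H.odd; simp [h] at this

lemma eq_co (z : R) : z = am (H.ca z) + am (H.cb z) * x := (H.ex z).choose_spec

lemma co_unique {z : R} {a b : F[X]} (h : z = am a + am b * x) : H.ca z = a ∧ H.cb z = b := by
  have h1 := H.eq_co z
  have h2 := H.inj (H.ca z - a) (H.cb z - b) (by
    rw [map_sub, map_sub]; linear_combination h - h1)
  exact ⟨sub_eq_zero.mp h2.1, sub_eq_zero.mp h2.2⟩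

lemma ca_add (z w : R) : H.ca (z + w) = H.ca z + H.ca w :=
  (H.co_unique (b := H.cb z + H.cb w) (by
    rw [map_add, map_add]; linear_combination H.eq_co z + H.eq_co w)).1
lemma cb_add (z w : R) : H.cb (z + w) = H.cb z + H.cb w :=
  (H.co_unique (a := H.ca z + H.ca w) (by
    rw [map_add, map_add]; linear_combination H.eq_co z + H.eq_co w)).2
lemma ca_neg (z : R) : H.ca (-z) = - H.ca z :=
  (H.co_unique (b := - H.cb z) (by
    rw [map_neg, map_neg]; linear_combination - H.eq_co z)).1
lemma cb_neg (z : R) : H.cb (-z) = - H.cb z :=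
  (H.co_unique (a := - H.ca z) (by
    rw [map_neg, map_neg]; linear_combination - H.eq_co z)).2
lemma ca_sub (z w : R) : H.ca (z - w) = H.ca z - H.ca w := by
  rw [sub_eq_add_neg, ca_add, ca_neg, sub_eq_add_neg]
lemma cb_sub (z w : R) : H.cb (z - w) = H.cb z - H.cb w := by
  rw [sub_eq_add_neg, cb_add, cb_neg, sub_eq_add_neg]
lemma co_mul (z w : R) : H.ca (z * w) = H.ca z * H.ca w + f * H.cb z * H.cb w ∧
    H.cb (z * w) = H.ca z * H.cb w + H.cb z * H.ca w := by
  apply H.co_unique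
  simp only [map_add, map_mul]
  rw [← H.sq]
  conv_lhs => rw [H.eq_co z, H.eq_co w]
  ring
lemma co_am (a : F[X]) : H.ca (am a) = a ∧ H.cb (am a) = 0 := by
  apply H.co_unique; simp
lemma co_x : H.ca x = 0 ∧ H.cb x = 1 := by
  apply H.co_unique; simp
lemma co_zero : H.ca 0 = 0 ∧ H.cb 0 = 0 := by
  apply H.co_unique; simp
lemma co_am_mul (a : F[X]) (z : R) : H.ca (am a * z) = a * H.ca z ∧ H.cb (am a * z) = a * H.cb z := by
  have := H.co_mul (am a) z
  rw [(H.co_am a).1, (H.co_am a).2] at this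
  simpa using this
lemma eq_zero_of (z : R) (h1 : H.ca z = 0) (h2 : H.cb z = 0) : z = 0 := by
  rw [H.eq_co z, h1, h2]; simp

/-- the norm -/
noncomputable def nrm (z : R) : F[X] := H.ca z ^ 2 - f * H.cb z ^ 2
/-- degree -/
noncomputable def D (z : R) : ℕ := (H.nrm z).natDegree

lemma nrm_mul (z w : R) : H.nrm (z * w) = H.nrm z * H.nrm w := by
  unfold nrm; rw [(H.co_mul z w).1, (H.co_mul z w).2]; ring

include H in
lemma deg_b {b : F[X]} (hb : b ≠ 0) : (f * b ^ 2).natDegree = 2 * b.natDegree + f.natDegree := by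
  rw [natDegree_mul H.f_ne (pow_ne_zero 2 hb), natDegree_pow]; ring

/-- case analysis for the norm -/
lemma D_cases (z : R) : (z = 0) ∨
    (z ≠ 0 ∧ H.nrm z ≠ 0 ∧ H.ca z ≠ 0 ∧ H.D z = 2 * (H.ca z).natDegree ∧
      (H.cb z ≠ 0 → 2 * (H.cb z).natDegree + f.natDegree < H.D z)) ∨
    (z ≠ 0 ∧ H.nrm z ≠ 0 ∧ H.cb z ≠ 0 ∧ H.D z = 2 * (H.cb z).natDegree + f.natDegree ∧
      (H.ca z ≠ 0 → 2 * (H.ca z).natDegree < H.D z)) := by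
  obtain ⟨k, hk⟩ := H.odd
  have hz0 : ∀ {z}, z ≠ 0 → ¬ (H.ca z = 0 ∧ H.cb z = 0) := fun hz h => hz (H.eq_zero_of _ h.1 h.2)
  by_cases hz : z = 0
  · exact Or.inl hz
  right
  by_cases ha : H.ca z = 0
  · have hb : H.cb z ≠ 0 := fun hb => hz0 hz ⟨ha, hb⟩
    right
    have e : H.nrm z = - (f * H.cb z ^ 2) := by unfold nrm; rw [ha]; ring
    refine ⟨hz, ?_, hb, ?_, fun h => absurd ha h⟩
    · rw [e]; exact neg_ne_zero.mpr (mul_ne_zero H.f_ne (pow_ne_zero 2 hb))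
    · unfold D; rw [e, natDegree_neg, H.deg_b hb]
  by_cases hb : H.cb z = 0
  · left
    have e : H.nrm z = H.ca z ^ 2 := by unfold nrm; rw [hb]; ring
    refine ⟨hz, ?_, ha, ?_, fun h => absurd hb h⟩
    · rw [e]; exact pow_ne_zero 2 ha
    · unfold D; rw [e, natDegree_pow]
  have h1 := H.deg_b hb
  have h2 : (H.ca z ^ 2).natDegree = 2 * (H.ca z).natDegree := natDegree_pow _ _
  rcases lt_or_gt_of_ne (show 2 * (H.ca z).natDegree ≠ 2 * (H.cb z).natDegree + f.natDegree by omega) with h | h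
  · right
    have hD : H.D z = 2 * (H.cb z).natDegree + f.natDegree := by
      unfold D nrm; rw [natDegree_sub_eq_right_of_natDegree_lt (by omega), h1]
    refine ⟨hz, ?_, hb, hD, fun _ => by omega⟩
    intro h0; unfold D at hD; rw [h0, natDegree_zero] at hD; omega
  · left
    have hD : H.D z = 2 * (H.ca z).natDegree := by
      unfold D nrm; rw [natDegree_sub_eq_left_of_natDegree_lt (by omega), h2]
    refine ⟨hz, ?_, ha, hD, fun _ => by omega⟩
    intro h0; unfold D at hD; rw [h0, natDegree_zero] at hD; omega

lemma nrm_ne {z : R} (hz : z ≠ 0) : H.nrm z ≠ 0 := by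
  rcases H.D_cases z with h | h | h
  · exact absurd h hz
  · exact h.2.1
  · exact h.2.1

lemma D_mul {z w : R} (hz : z ≠ 0) (hw : w ≠ 0) : H.D (z * w) = H.D z + H.D w := by
  unfold D; rw [nrm_mul, natDegree_mul (H.nrm_ne hz) (H.nrm_ne hw)]

lemma D_am (a : F[X]) : H.D (am a) = 2 * a.natDegree := by
  unfold D nrm; rw [(H.co_am a).1, (H.co_am a).2]; simp [natDegree_pow]

lemma D_x : H.D x = f.natDegree := by
  unfold D nrm; rw [H.co_x.1, H.co_x.2]; simp

include H in
lemma am_ne {a : F[X]} (ha : a ≠ 0) : am a ≠ 0 := by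
  intro h
  exact ha (H.inj a 0 (by simp [h])).1

include H in
lemma x_ne : x ≠ 0 := by
  intro h
  exact one_ne_zero (H.inj 0 1 (by simp [h])).2

lemma D_am_mul {a : F[X]} (ha : a ≠ 0) {z : R} (hz : z ≠ 0) :
    H.D (am a * z) = 2 * a.natDegree + H.D z := by
  rw [H.D_mul (H.am_ne ha) hz, D_am]

/-- coordinates bounded -/
def Lt (z : R) (m : ℕ) : Prop := (H.ca z ≠ 0 → 2 * (H.ca z).natDegree < m) ∧
  (H.cb z ≠ 0 → 2 * (H.cb z).natDegree + f.natDegree < m)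

lemma Lt_iff (z : R) (m : ℕ) : H.Lt z m ↔ (z = 0 ∨ H.D z < m) := by
  rcases H.D_cases z with h | h | h
  · subst h; simp [Lt, H.co_zero]
  · obtain ⟨h0, -, h1, h2, h3⟩ := h
    simp only [Lt, h0, false_or]
    constructor
    · intro h; have := h.1 h1; omega
    · intro h; exact ⟨fun _ => by omega, fun hb => (h3 hb).trans h⟩
  · obtain ⟨h0, -, h1, h2, h3⟩ := h
    simp only [Lt, h0, false_or]
    constructor
    · intro h; have := h.2 h1; omega
    · intro h; exact ⟨fun hb => (h3 hb).trans h, fun _ => by omega⟩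

lemma Lt.add {z w : R} {m : ℕ} (hz : H.Lt z m) (hw : H.Lt w m) : H.Lt (z + w) m := by
  unfold Lt at *
  rw [ca_add, cb_add]
  constructor
  · intro h
    have := natDegree_add_le (H.ca z) (H.ca w)
    rcases eq_or_ne (H.ca z) 0 with h1 | h1
    · rw [h1, zero_add] at h ⊢; exact hw.1 h
    rcases eq_or_ne (H.ca w) 0 with h2 | h2
    · rw [h2, add_zero]; exact hz.1 h1
    have := hz.1 h1; have := hw.1 h2; omega
  · intro h
    have := natDegree_add_le (H.cb z) (H.cb w)
    rcases eq_or_ne (H.cb z) 0 with h1 | h1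
    · rw [h1, zero_add] at h ⊢; exact hw.2 h
    rcases eq_or_ne (H.cb w) 0 with h2 | h2
    · rw [h2, add_zero]; exact hz.2 h1
    have := hz.2 h1; have := hw.2 h2; omega

lemma Lt.neg {z : R} {m : ℕ} (hz : H.Lt z m) : H.Lt (-z) m := by
  unfold Lt at *
  rw [ca_neg, cb_neg]; simpa using hz

lemma Lt.mono {z : R} {m n : ℕ} (hz : H.Lt z m) (h : m ≤ n) : H.Lt z n := by
  rw [Lt_iff] at *; rcases hz with h | h
  · exact Or.inl h
  · right; omega

/-- elements of degree `< m` -/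
def Rm (m : ℕ) : AddSubgroup R where
  carrier := {z | H.Lt z m}
  add_mem' := fun hz hw => Lt.add H hz hw
  zero_mem' := (H.Lt_iff 0 m).mpr (Or.inl rfl)
  neg_mem' := fun hz => Lt.neg H hz

lemma mem_Rm {z : R} {m : ℕ} : z ∈ H.Rm m ↔ (z = 0 ∨ H.D z < m) := H.Lt_iff z m

lemma cancel {z w : R} (hz : z ≠ 0) (hw : w ≠ 0) (h : H.D z = H.D w) :
    ∃ c : F[X], z - am c * w ∈ H.Rm (H.D z) := by
  obtain ⟨k, hk⟩ := H.odd
  rcases H.D_cases z with h1 | h1 | h1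
  · exact absurd h1 hz
  · rcases H.D_cases w with h2 | h2 | h2
    · exact absurd h2 hw
    · obtain ⟨-, -, ha, h3, h4⟩ := h1
      obtain ⟨-, -, ha', h3', h4'⟩ := h2
      set c := (H.ca z).leadingCoeff / (H.ca w).leadingCoeff with hc
      have hl : (H.ca w).leadingCoeff ≠ 0 := leadingCoeff_ne_zero.mpr ha'
      have hl' : (H.ca z).leadingCoeff ≠ 0 := leadingCoeff_ne_zero.mpr ha
      have hc0 : c ≠ 0 := div_ne_zero hl' hl
      refine ⟨C c, ?_⟩
      change H.Lt _ _
      unfold Lt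
      rw [ca_sub, cb_sub, (H.co_am_mul _ _).1, (H.co_am_mul _ _).2]
      constructor
      · intro hne
        have : (H.ca z - C c * H.ca w).natDegree < (H.ca z).natDegree := by
          apply natDegree_lt_natDegree hne
          apply degree_sub_lt_left
          · rw [degree_C_mul hc0, degree_eq_natDegree ha, degree_eq_natDegree ha']
            congr 1; omega
          · exact ha
          · rw [leadingCoeff_mul, leadingCoeff_C, hc, div_mul_cancel₀ _ hl]
        omega
      · intro hne
        have hle := natDegree_sub_le (H.cb z) (C c * H.cb w)
        rw [natDegree_C_mul hc0] at hle
        rcases eq_or_ne (H.cb z) 0 with e1 | e1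
        · rcases eq_or_ne (H.cb w) 0 with e2 | e2
          · simp [e1, e2] at hne
          · have := h4' e2; rw [e1, natDegree_zero] at hle; rw [e1]; omega
        · rcases eq_or_ne (H.cb w) 0 with e2 | e2
          · have := h4 e1; rw [e2, natDegree_zero] at hle; rw [e2]; omega
          · have := h4 e1; have := h4' e2; omega
    · exfalso; omega
  · rcases H.D_cases w with h2 | h2 | h2
    · exact absurd h2 hw
    · exfalso; omega
    · obtain ⟨-, -, ha, h3, h4⟩ := h1
      obtain ⟨-, -, ha', h3', h4'⟩ := h2
      set c := (H.cb z).leadingCoeff / (H.cb w).leadingCoeff with hc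
      have hl : (H.cb w).leadingCoeff ≠ 0 := leadingCoeff_ne_zero.mpr ha'
      have hl' : (H.cb z).leadingCoeff ≠ 0 := leadingCoeff_ne_zero.mpr ha
      have hc0 : c ≠ 0 := div_ne_zero hl' hl
      refine ⟨C c, ?_⟩
      change H.Lt _ _
      unfold Lt
      rw [ca_sub, cb_sub, (H.co_am_mul _ _).1, (H.co_am_mul _ _).2]
      constructor
      · intro hne
        have hle := natDegree_sub_le (H.ca z) (C c * H.ca w)
        rw [natDegree_C_mul hc0] at hle
        rcases eq_or_ne (H.ca z) 0 with e1 | e1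
        · rcases eq_or_ne (H.ca w) 0 with e2 | e2
          · simp [e1, e2] at hne
          · have := h4' e2; rw [e1, natDegree_zero] at hle; rw [e1]; omega
        · rcases eq_or_ne (H.ca w) 0 with e2 | e2
          · have := h4 e1; rw [e2, natDegree_zero] at hle; rw [e2]; omega
          · have := h4 e1; have := h4' e2; omega
      · intro hne
        have : (H.cb z - C c * H.cb w).natDegree < (H.cb z).natDegree := by
          apply natDegree_lt_natDegree hne
          apply degree_sub_lt_left
          · rw [degree_C_mul hc0, degree_eq_natDegree ha, degree_eq_natDegree ha']
            congr 1; omega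
          · exact ha
          · rw [leadingCoeff_mul, leadingCoeff_C, hc, div_mul_cancel₀ _ hl]
        omega

/-- Reduction modulo `u`, `v`. -/
lemma reduce {u v : R} (hu : u ≠ 0) (hv : v ≠ 0) (hue : Even (H.D u)) (hvo : Odd (H.D v)) (w : R) :
    ∃ a b : F[X], w - am a * u - am b * v = 0 ∨
      (Even (H.D (w - am a * u - am b * v)) ∧ H.D (w - am a * u - am b * v) < H.D u) ∨
      (Odd (H.D (w - am a * u - am b * v)) ∧ H.D (w - am a * u - am b * v) < H.D v) := by
  have key : ∀ n : ℕ, ∀ w : R, w ∈ H.Rm n → ∃ a b : F[X], w - am a * u - am b * v = 0 ∨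
      (Even (H.D (w - am a * u - am b * v)) ∧ H.D (w - am a * u - am b * v) < H.D u) ∨
      (Odd (H.D (w - am a * u - am b * v)) ∧ H.D (w - am a * u - am b * v) < H.D v) := by
    intro n
    induction n with
    | zero =>
      intro w hw
      rw [mem_Rm] at hw
      refine ⟨0, 0, Or.inl ?_⟩
      simpa using hw
    | succ n ih =>
      intro w hw
      by_cases hw' : w ∈ H.Rm n
      · exact ih w hw'
      rw [mem_Rm] at hw hw'
      push Not at hw'
      have hw0 := hw'.1
      have hwn : H.D w = n := by
        rcases hw with h | h
        · exact absurd h hw0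
        · omega
      rcases Nat.even_or_odd n with hn | hn
      · by_cases hlt : n < H.D u
        · refine ⟨0, 0, Or.inr (Or.inl ?_)⟩
          simp only [map_zero, zero_mul, sub_zero]
          rw [hwn]; exact ⟨hn, hlt⟩
        · obtain ⟨k1, hk1⟩ := hn
          obtain ⟨k2, hk2⟩ := hue
          have hX : (X ^ (k1 - k2) : F[X]) ≠ 0 := pow_ne_zero _ X_ne_zero
          have hXu := H.D_am_mul hX hu
          rw [natDegree_X_pow] at hXu
          obtain ⟨c, hc⟩ := H.cancel hw0
            (w := am (X ^ (k1 - k2)) * u) (by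
              intro h0; have := H.nrm_mul (am (X ^ (k1-k2))) u
              rw [h0] at this
              have h3 := mul_ne_zero (H.nrm_ne (H.am_ne hX)) (H.nrm_ne hu)
              rw [← this] at h3
              apply h3; unfold nrm; simp [H.co_zero]) (by omega)
          rw [hwn] at hc
          obtain ⟨a, b, hab⟩ := ih _ hc
          refine ⟨a + c * X ^ (k1 - k2), b, ?_⟩
          have e : w - am (a + c * X ^ (k1 - k2)) * u - am b * v =
            w - am c * (am (X ^ (k1 - k2)) * u) - am a * u - am b * v := by
            rw [map_add, map_mul]; ring
          rw [e]; exact hab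
      · by_cases hlt : n < H.D v
        · refine ⟨0, 0, Or.inr (Or.inr ?_)⟩
          simp only [map_zero, zero_mul, sub_zero]
          rw [hwn]; exact ⟨hn, hlt⟩
        · obtain ⟨k1, hk1⟩ := hn
          obtain ⟨k2, hk2⟩ := hvo
          have hX : (X ^ (k1 - k2) : F[X]) ≠ 0 := pow_ne_zero _ X_ne_zero
          have hXu := H.D_am_mul hX hv
          rw [natDegree_X_pow] at hXu
          obtain ⟨c, hc⟩ := H.cancel hw0
            (w := am (X ^ (k1 - k2)) * v) (by
              intro h0; have := H.nrm_mul (am (X ^ (k1-k2))) v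
              rw [h0] at this
              have h3 := mul_ne_zero (H.nrm_ne (H.am_ne hX)) (H.nrm_ne hv)
              rw [← this] at h3
              apply h3; unfold nrm; simp [H.co_zero]) (by omega)
          rw [hwn] at hc
          obtain ⟨a, b, hab⟩ := ih _ hc
          refine ⟨a, b + c * X ^ (k1 - k2), ?_⟩
          have e : w - am a * u - am (b + c * X ^ (k1 - k2)) * v =
            w - am c * (am (X ^ (k1 - k2)) * v) - am a * u - am b * v := by
            rw [map_add, map_mul]; ring
          rw [e]; exact hab
  exact key (H.D w + 1) w (H.mem_Rm.mpr (Or.inr (Nat.lt_succ_self _)))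

/-- elements of different degree -/
lemma add_mem_Rm_iff {z w : R} (h : z = 0 ∨ w = 0 ∨ H.D z ≠ H.D w) (m : ℕ) :
    z + w ∈ H.Rm m ↔ z ∈ H.Rm m ∧ w ∈ H.Rm m := by
  refine ⟨fun hs => ?_, fun h => add_mem h.1 h.2⟩
  rcases h with rfl | rfl | h
  · rw [zero_add] at hs; exact ⟨zero_mem _, hs⟩
  · rw [add_zero] at hs; exact ⟨hs, zero_mem _⟩
  wlog hlt : H.D w < H.D z generalizing z w
  · have := this (z := w) (w := z) (by rwa [add_comm]) h.symm (by omega)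
    exact this.symm
  have hz : z ∈ H.Rm m := by
    by_contra hz
    have hz' := hz
    rw [mem_Rm] at hz'
    push Not at hz'
    have h1 : z + w ∈ H.Rm (H.D z) := Lt.mono H hs hz'.2
    have h2 : w ∈ H.Rm (H.D z) := H.mem_Rm.mpr (Or.inr hlt)
    have h3 := sub_mem h1 h2
    rw [add_sub_cancel_right, mem_Rm] at h3
    rcases h3 with h3 | h3
    · exact hz'.1 h3
    · omega
  refine ⟨hz, ?_⟩
  have := sub_mem hs hz
  rwa [add_sub_cancel_left] at this

end HR
end HypE
end

section
open Polynomial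

set_option linter.all false

namespace HypE
namespace HR
variable {F : Type*} [Field F] {f : F[X]} {R : Type*} [CommRing R] [IsDomain R] [Algebra F[X] R] {x : R}
  (H : HR f x)

local notation "am" => algebraMap F[X] R

/-- `u`, `v` is a reduced basis of `I`. -/
structure Bas (I : Ideal R) (u v : R) : Prop where
  u0 : u ≠ 0
  v0 : v ≠ 0
  ue : Even (H.D u)
  vo : Odd (H.D v)
  mem : ∀ w, w ∈ I ↔ ∃ a b : F[X], w = am a * u + am b * v

lemma Bas.umem {I : Ideal R} {u v : R} (h : H.Bas I u v) : u ∈ I :=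
  (h.mem u).mpr ⟨1, 0, by simp⟩
lemma Bas.vmem {I : Ideal R} {u v : R} (h : H.Bas I u v) : v ∈ I :=
  (h.mem v).mpr ⟨0, 1, by simp⟩

lemma exists_bas (I : Ideal R) (hI : I ≠ ⊥) : ∃ u v, H.Bas I u v := by
  obtain ⟨z, hz, hz0⟩ := Submodule.exists_mem_ne_zero_of_ne_bot hI
  have hzx0 : z * x ≠ 0 := mul_ne_zero hz0 H.x_ne
  have hzx : z * x ∈ I := I.mul_mem_right _ hz
  have hD : H.D (z * x) = H.D z + f.natDegree := by rw [H.D_mul hz0 H.x_ne, D_x]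
  have hpar : ∃ a b : R, a ∈ I ∧ b ∈ I ∧ a ≠ 0 ∧ b ≠ 0 ∧ Even (H.D a) ∧ Odd (H.D b) := by
    rcases Nat.even_or_odd (H.D z) with h | h
    · exact ⟨z, z * x, hz, hzx, hz0, hzx0, h, by rw [hD]; exact h.add_odd H.odd⟩
    · exact ⟨z * x, z, hzx, hz, hzx0, hz0, by rw [hD]; exact h.add_odd H.odd, h⟩
  obtain ⟨a, b, ha, hb, ha0, hb0, hae, hbo⟩ := hpar
  have hE : ∃ n, ∃ u, u ∈ I ∧ u ≠ 0 ∧ Even (H.D u) ∧ H.D u = n := ⟨_, a, ha, ha0, hae, rfl⟩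
  have hO : ∃ n, ∃ u, u ∈ I ∧ u ≠ 0 ∧ Odd (H.D u) ∧ H.D u = n := ⟨_, b, hb, hb0, hbo, rfl⟩
  classical
  obtain ⟨u, hu, hu0, hue, hun⟩ := Nat.find_spec hE
  obtain ⟨v, hv, hv0, hvo, hvn⟩ := Nat.find_spec hO
  refine ⟨u, v, hu0, hv0, hue, hvo, fun w => ⟨fun hw => ?_, ?_⟩⟩
  · obtain ⟨a, b, h⟩ := H.reduce hu0 hv0 hue hvo w
    refine ⟨a, b, ?_⟩
    have hmem : w - am a * u - am b * v ∈ I :=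
      I.sub_mem (I.sub_mem hw (I.mul_mem_left _ hu)) (I.mul_mem_left _ hv)
    by_cases h0 : w - am a * u - am b * v = 0
    · linear_combination h0
    exfalso
    rcases h with h | h | h
    · exact h0 h
    · rw [hun] at h
      exact Nat.find_min hE h.2 ⟨_, hmem, h0, h.1, rfl⟩
    · rw [hvn] at h
      exact Nat.find_min hO h.2 ⟨_, hmem, h0, h.1, rfl⟩
  · rintro ⟨a, b, rfl⟩
    exact I.add_mem (I.mul_mem_left _ hu) (I.mul_mem_left _ hv)

lemma bas_top : H.Bas ⊤ 1 x := by
  refine ⟨one_ne_zero, H.x_ne, ?_, ?_, fun w => ⟨fun _ => ?_, fun _ => trivial⟩⟩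
  · have := H.D_am 1; rw [map_one] at this; simp [this]
  · rw [H.D_x]; exact H.odd
  · exact ⟨_, _, by rw [mul_one]; exact H.eq_co w⟩

lemma D_one : H.D 1 = 0 := by
  have := H.D_am 1; rw [map_one] at this; simp [this]

/-- piece of an ideal of bounded degree -/
def Im (I : Ideal R) (m : ℕ) : AddSubgroup R := Submodule.toAddSubgroup I ⊓ H.Rm m

lemma mem_Im {I : Ideal R} {m : ℕ} {z : R} : z ∈ H.Im I m ↔ z ∈ I ∧ z ∈ H.Rm m := Iff.rfl

lemma bas_mem_Rm {I : Ideal R} {u v : R} (h : H.Bas I u v) (a b : F[X]) (m : ℕ) :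
    am a * u + am b * v ∈ H.Rm m ↔
      a ∈ degreeLT F ((m + 1 - H.D u) / 2) ∧ b ∈ degreeLT F ((m + 1 - H.D v) / 2) := by
  have key : ∀ (a : F[X]) (u : R), u ≠ 0 →
      (am a * u ∈ H.Rm m ↔ a ∈ degreeLT F ((m + 1 - H.D u) / 2)) := by
    intro a u hu
    rw [mem_Rm, mem_degreeLT]
    rcases eq_or_ne a 0 with rfl | ha
    · simp
    · rw [H.D_am_mul ha hu, degree_eq_natDegree ha, Nat.cast_lt]
      simp only [mul_eq_zero, H.am_ne ha, hu, or_false, false_or]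
      omega
  rw [add_mem_Rm_iff, key a u h.u0, key b v h.v0]
  rcases eq_or_ne a 0 with rfl | ha
  · left; simp
  rcases eq_or_ne b 0 with rfl | hb
  · right; left; simp
  right; right
  rw [H.D_am_mul ha h.u0, H.D_am_mul hb h.v0]
  obtain ⟨k, hk⟩ := h.ue
  obtain ⟨l, hl⟩ := h.vo
  omega

lemma bas_inj {I : Ideal R} {u v : R} (h : H.Bas I u v) {a b : F[X]}
    (h0 : am a * u + am b * v = 0) : a = 0 ∧ b = 0 := by
  have := (H.bas_mem_Rm h a b 0).mp (by rw [h0]; exact zero_mem _)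
  obtain ⟨l, hl⟩ := h.vo
  have e1 : (0 + 1 - H.D u) / 2 = 0 := by omega
  have e2 : (0 + 1 - H.D v) / 2 = 0 := by omega
  rw [e1, e2] at this
  simpa [mem_degreeLT] using this

lemma card_degreeLT (n : ℕ) : Nat.card (degreeLT F n) = Nat.card F ^ n := by
  rw [Nat.card_congr (degreeLTEquiv F n).toEquiv, Nat.card_fun, Nat.card_fin]

lemma card_Im {I : Ideal R} {u v : R} (h : H.Bas I u v) (m : ℕ) :
    Nat.card (H.Im I m) = Nat.card F ^ ((m + 1 - H.D u) / 2 + (m + 1 - H.D v) / 2) := by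
  rw [pow_add, ← card_degreeLT, ← card_degreeLT, ← Nat.card_prod]
  symm
  apply Nat.card_congr
  refine Equiv.ofBijective (fun ab => ⟨am ab.1 * u + am ab.2 * v,
    (h.mem _).mpr ⟨_, _, rfl⟩, (H.bas_mem_Rm h _ _ m).mpr ⟨ab.1.2, ab.2.2⟩⟩) ⟨?_, ?_⟩
  · rintro ⟨⟨a, ha⟩, ⟨b, hb⟩⟩ ⟨⟨a', ha'⟩, ⟨b', hb'⟩⟩ hab
    have hab : am a * u + am b * v = am a' * u + am b' * v := congrArg Subtype.val hab
    have := H.bas_inj h (a := a - a') (b := b - b') (by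
      rw [map_sub, map_sub]; linear_combination hab)
    simp only [sub_eq_zero] at this
    simp [this]
  · rintro ⟨z, hz, hz'⟩
    obtain ⟨a, b, rfl⟩ := (h.mem z).mp hz
    have := (H.bas_mem_Rm h _ _ m).mp hz'
    exact ⟨⟨⟨a, this.1⟩, ⟨b, this.2⟩⟩, rfl⟩

variable [Finite F]

instance finite_Im (I : Ideal R) (m : ℕ) : Finite (H.Im I m) := by
  have : Finite (H.Im ⊤ m) := by
    apply Nat.finite_of_card_ne_zero
    rw [H.card_Im H.bas_top]
    exact pow_ne_zero _ Nat.card_pos.ne'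
  exact Finite.of_injective (β := H.Im ⊤ m) (fun z => ⟨z.1, trivial, z.2.2⟩) (by
    intro a b hab; exact Subtype.ext (congrArg (fun z : H.Im ⊤ m => z.1) hab))

lemma card_quot_mul {I : Ideal R} {u v : R} (h : H.Bas I u v) (m : ℕ) (h1 : H.D u ≤ m) (h2 : H.D v ≤ m) :
    Nat.card (R ⧸ I) * Nat.card (H.Im I m) = Nat.card (H.Im ⊤ m) := by
  have hsup : Submodule.toAddSubgroup I ⊔ H.Im ⊤ m = ⊤ := by
    rw [eq_top_iff]
    intro w _
    obtain ⟨a, b, hab⟩ := H.reduce h.u0 h.v0 h.ue h.vo w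
    have e : w = (am a * u + am b * v) + (w - am a * u - am b * v) := by ring
    rw [e]
    refine AddSubgroup.add_mem_sup ((h.mem _).mpr ⟨_, _, rfl⟩) ⟨trivial, ?_⟩
    change _ ∈ H.Rm m
    rw [mem_Rm]
    rcases hab with h | h | h
    · exact Or.inl h
    · right; omega
    · right; omega
  have e1 : Nat.card (R ⧸ I) = (Submodule.toAddSubgroup I).index := rfl
  have e2 : H.Im I m = Submodule.toAddSubgroup I ⊓ H.Im ⊤ m := by
    ext z; constructor
    · rintro ⟨h1, h2⟩; exact ⟨h1, trivial, h2⟩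
    · rintro ⟨h1, _, h2⟩; exact ⟨h1, h2⟩
  have e3 : (H.Im I m).relIndex (H.Im ⊤ m) = (Submodule.toAddSubgroup I).index := by
    rw [e2, AddSubgroup.inf_relIndex_right, ← AddSubgroup.relIndex_sup_right, sup_comm, hsup,
      AddSubgroup.relIndex_top_right]
  rw [e1, ← e3, mul_comm]
  have := AddSubgroup.relIndex_mul_relIndex ⊥ (H.Im I m) (H.Im ⊤ m) bot_le (by rw [e2]; exact inf_le_right)
  rwa [AddSubgroup.relIndex_bot_left, AddSubgroup.relIndex_bot_left] at this

/-- degree of an ideal -/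
noncomputable def dg (I : Ideal R) : ℕ := Nat.log (Nat.card F) (Nat.card (R ⧸ I))

omit [Finite F] in
lemma q1 [Finite F] : 1 < Nat.card F := Finite.one_lt_card

lemma bas_card {I : Ideal R} {u v : R} (h : H.Bas I u v) :
    Nat.card (R ⧸ I) = Nat.card F ^ dg (F := F) I ∧ H.D u + H.D v = 2 * dg (F := F) I + f.natDegree := by
  have hq : 1 < Nat.card F := Finite.one_lt_card
  set q := Nat.card F with hqd
  obtain ⟨a, ha⟩ := h.ue
  obtain ⟨b, hb⟩ := h.vo
  obtain ⟨g, hg⟩ := H.odd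
  set M := a + b + g + 5 with hM
  have key := H.card_quot_mul h (2 * M) (by omega) (by omega)
  rw [H.card_Im h, H.card_Im H.bas_top, H.D_one, H.D_x,
    show (2 * M + 1 - 0) / 2 + (2 * M + 1 - f.natDegree) / 2 = 2 * M - g by omega,
    show (2 * M + 1 - H.D u) / 2 + (2 * M + 1 - H.D v) / 2 = 2 * M - a - b by omega] at key
  set c := Nat.card (R ⧸ I) with hc
  rw [← hqd] at key
  have hc0 : c ≠ 0 := by
    rintro h0; rw [h0, zero_mul] at key
    exact pow_ne_zero _ (by omega) key.symm
  have hab : g ≤ a + b := by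
    by_contra hlt
    have h1 : q ^ (2 * M - g) < q ^ (2 * M - a - b) := Nat.pow_lt_pow_right hq (by omega)
    have h2 : q ^ (2 * M - a - b) ≤ c * q ^ (2 * M - a - b) := Nat.le_mul_of_pos_left _ (by omega)
    omega
  have hc2 : c = q ^ (a + b - g) := by
    rw [show 2 * M - g = (a + b - g) + (2 * M - a - b) by omega, pow_add] at key
    exact Nat.eq_of_mul_eq_mul_right (by positivity) key
  have hd : dg (F := F) I = a + b - g := by
    unfold dg; rw [← hc, ← hqd, hc2, Nat.log_pow hq]
  rw [hd]
  exact ⟨hc2, by omega⟩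

include H in
lemma card_quot {I : Ideal R} (hI : I ≠ ⊥) : Nat.card (R ⧸ I) = Nat.card F ^ dg (F := F) I := by
  obtain ⟨u, v, h⟩ := H.exists_bas I hI
  exact (H.bas_card h).1

include H in
lemma finite_quot {I : Ideal R} (hI : I ≠ ⊥) : Finite (R ⧸ I) := by
  apply Nat.finite_of_card_ne_zero
  rw [H.card_quot hI]
  have : 1 < Nat.card F := Finite.one_lt_card
  exact pow_ne_zero _ (by omega)

lemma dg_span {z : R} (hz : z ≠ 0) : dg (F := F) (Ideal.span {z}) = H.D z := by
  have hzx0 : z * x ≠ 0 := mul_ne_zero hz H.x_ne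
  have hD : H.D (z * x) = H.D z + f.natDegree := by rw [H.D_mul hz H.x_ne, D_x]
  have hm : ∀ w, w ∈ Ideal.span {z} ↔ ∃ a b : F[X], w = am a * z + am b * (z * x) := by
    intro w
    rw [Ideal.mem_span_singleton']
    constructor
    · rintro ⟨c, rfl⟩
      exact ⟨H.ca c, H.cb c, by conv_lhs => rw [H.eq_co c]
                                ring⟩
    · rintro ⟨a, b, rfl⟩
      exact ⟨am a + am b * x, by ring⟩
  rcases Nat.even_or_odd (H.D z) with h | h
  · have := (H.bas_card (I := Ideal.span {z}) (u := z) (v := z * x)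
      ⟨hz, hzx0, h, by rw [hD]; exact h.add_odd H.odd, hm⟩).2
    omega
  · have := (H.bas_card (I := Ideal.span {z}) (u := z * x) (v := z)
      ⟨hzx0, hz, by rw [hD]; exact h.add_odd H.odd, h, fun w => by
        rw [hm]; constructor
        · rintro ⟨a, b, rfl⟩; exact ⟨b, a, by ring⟩
        · rintro ⟨a, b, rfl⟩; exact ⟨b, a, by ring⟩⟩).2
    omega

include H in
lemma dg_le {I J : Ideal R} (hI : I ≠ ⊥) (h : I ≤ J) : dg (F := F) J ≤ dg (F := F) I := by
  have := H.finite_quot hI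
  unfold dg
  apply Nat.log_mono_right
  exact Nat.card_le_card_of_surjective _ (Ideal.Quotient.factor_surjective h)

include H in
lemma eq_of_dg {I J : Ideal R} (hI : I ≠ ⊥) (h : I ≤ J) (hd : dg (F := F) J = dg (F := F) I) : I = J := by
  have := H.finite_quot hI
  have hJ : J ≠ ⊥ := by rintro rfl; exact hI (le_bot_iff.mp h)
  have hJf := H.finite_quot hJ
  have hc : Nat.card (R ⧸ I) = Nat.card (R ⧸ J) := by rw [H.card_quot hI, H.card_quot hJ, hd]
  have hb : Function.Bijective (Ideal.Quotient.factor h) :=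
    (Function.Surjective.bijective_of_nat_card_le (Ideal.Quotient.factor_surjective h) hc.le)
  apply le_antisymm h
  intro z hz
  rw [← Ideal.Quotient.eq_zero_iff_mem] at hz ⊢
  apply hb.1
  rw [map_zero, Ideal.Quotient.factor_mk, hz]

lemma dg_le_D {I : Ideal R} {z : R} (hz : z ∈ I) (hz0 : z ≠ 0) : dg (F := F) I ≤ H.D z := by
  rw [← H.dg_span hz0]
  exact H.dg_le (by simpa using hz0) (by rwa [Ideal.span_singleton_le_iff_mem])

/-- Riemann-Roch count. -/
lemma card_Im_large {I : Ideal R} (hI : I ≠ ⊥) (m : ℕ) (hm : dg (F := F) I + 2 * (f.natDegree / 2) ≤ m) :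
    Nat.card (H.Im I m) = Nat.card F ^ (m - dg (F := F) I - f.natDegree / 2) := by
  obtain ⟨u, v, h⟩ := H.exists_bas I hI
  rw [H.card_Im h]
  have h1 := H.dg_le_D (Bas.umem H h) h.u0
  have h2 := H.dg_le_D (Bas.vmem H h) h.v0
  have h3 := (H.bas_card h).2
  obtain ⟨a, ha⟩ := h.ue
  obtain ⟨b, hb⟩ := h.vo
  obtain ⟨g, hg⟩ := H.odd
  congr 1
  omega

lemma Im_small {I : Ideal R} (z : R) (hz : z ∈ H.Im I (dg (F := F) I)) : z = 0 := by
  by_contra h0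
  have := H.dg_le_D hz.1 h0
  rcases H.mem_Rm.mp hz.2 with h | h
  · exact h0 h
  · omega

end HR
end HypE
end

section
open Polynomial

set_option linter.all false

namespace HypE

lemma int_frac {A K : Type*} [CommRing A] [IsDomain A] [IsIntegrallyClosed A] [Field K] [Algebra A K]
    (hinj : Function.Injective (algebraMap A K)) (a n : A) (hn : n ≠ 0) (t : K)
    (ht : t * algebraMap A K n = algebraMap A K a) (hi : IsIntegral A t) : ∃ c, t = algebraMap A K c := by
  have : FaithfulSMul A K := (faithfulSMul_iff_algebraMap_injective A K).mpr hinj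
  letI := FractionRing.liftAlgebra A K
  have hn' : algebraMap A K n ≠ 0 := by
    intro h; exact hn (hinj (by rw [h, map_zero]))
  have e : t = algebraMap (FractionRing A) K (algebraMap A _ a / algebraMap A _ n) := by
    rw [map_div₀, ← IsScalarTower.algebraMap_apply, ← IsScalarTower.algebraMap_apply, ← ht]
    field_simp
  rw [e, isIntegral_algebraMap_iff (algebraMap (FractionRing A) K).injective,
    IsIntegrallyClosed.isIntegral_iff] at hi
  obtain ⟨c, hc⟩ := hi
  refine ⟨c, ?_⟩
  rw [e, ← hc, ← IsScalarTower.algebraMap_apply]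

lemma sq_dvd {F : Type*} [Field F] {f n b : F[X]} (hf : Squarefree f) (hn : n ≠ 0)
    (h : n ^ 2 ∣ b ^ 2 * f) : n ∣ b := by
  classical
  set d := EuclideanDomain.gcd n b with hd
  have hd0 : d ≠ 0 := fun h0 => hn ((EuclideanDomain.gcd_eq_zero_iff.mp h0).1)
  obtain ⟨n', hn'⟩ := EuclideanDomain.gcd_dvd_left n b
  obtain ⟨b', hb'⟩ := EuclideanDomain.gcd_dvd_right n b
  rw [← hd] at hn' hb'
  have hcop : IsCoprime n' b' := by
    have := EuclideanDomain.gcd_eq_gcd_ab n b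
    rw [← hd] at this
    refine ⟨EuclideanDomain.gcdA n b, EuclideanDomain.gcdB n b, ?_⟩
    apply mul_left_cancel₀ hd0
    linear_combination (-1 : F[X]) * this + (- EuclideanDomain.gcdA n b) * hn' + (- EuclideanDomain.gcdB n b) * hb'
  have h2 : n' ^ 2 ∣ b' ^ 2 * f := by
    rw [hn', hb', mul_pow, mul_pow, mul_assoc] at h
    exact (mul_dvd_mul_iff_left (pow_ne_zero 2 hd0)).mp h
  have h3 : n' ^ 2 ∣ f := (hcop.pow).dvd_of_dvd_mul_left h2
  have h4 : IsUnit n' := hf n' (by rwa [← sq])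
  rw [hn', hb']
  exact mul_dvd_mul_left d (h4.dvd)

theorem cardQuot_mul' {S : Type*} [CommRing S] [IsDedekindDomain S] [Infinite S] (I J : Ideal S) :
    Submodule.cardQuot (I * J) = Submodule.cardQuot I * Submodule.cardQuot J := by
  exact UniqueFactorizationMonoid.multiplicative_of_coprime Submodule.cardQuot I J
      (Submodule.cardQuot_bot _ _)
      (fun {I J} hI => by simp [Ideal.isUnit_iff.mp hI, Ideal.mul_top])
      (fun {I} i hI =>
        have : Ideal.IsPrime I := Ideal.isPrime_of_prime hI
        cardQuot_pow_of_prime hI.ne_zero)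
      fun {I J} hIJ => cardQuot_mul_of_coprime <| Ideal.isCoprime_iff_sup_eq.mpr
        (Ideal.isUnit_iff.mp
          (hIJ (Ideal.dvd_iff_le.mpr le_sup_left) (Ideal.dvd_iff_le.mpr le_sup_right)))

namespace HR
variable {F : Type*} [Field F] {f : F[X]} {R : Type*} [CommRing R] [IsDomain R] [Algebra F[X] R] {x : R}
  (H : HR f x)

local notation "am" => algebraMap F[X] R

include H in
lemma mfin : Module.Finite F[X] R := by
  classical
  refine ⟨⟨{1, x}, ?_⟩⟩
  rw [eq_top_iff]
  intro z _
  rw [H.eq_co z]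
  refine Submodule.add_mem _ ?_ ?_
  · have : (1 : R) ∈ Submodule.span F[X] (↑({1, x} : Finset R) : Set R) := Submodule.subset_span (by simp)
    have := Submodule.smul_mem _ (H.ca z) this
    rwa [Algebra.smul_def, mul_one] at this
  · have : x ∈ Submodule.span F[X] (↑({1, x} : Finset R) : Set R) := Submodule.subset_span (by simp)
    have := Submodule.smul_mem _ (H.cb z) this
    rwa [Algebra.smul_def] at this

include H in
lemma am_inj : Function.Injective am := by
  rw [injective_iff_map_eq_zero]
  intro a ha
  by_contra h
  exact H.am_ne h ha

/-- conjugation -/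
noncomputable def conj : R →ₐ[F[X]] R where
  toFun z := am (H.ca z) - am (H.cb z) * x
  map_one' := by
    have := H.co_am 1
    rw [map_one] at this; rw [this.1, this.2]; simp
  map_mul' z w := by
    rw [(H.co_mul z w).1, (H.co_mul z w).2]; simp only [map_add, map_mul]
    linear_combination (- am (H.cb z) * am (H.cb w)) * H.sq
  map_zero' := by rw [H.co_zero.1, H.co_zero.2]; simp
  map_add' z w := by rw [H.ca_add, H.cb_add]; simp only [map_add]; ring
  commutes' a := by rw [(H.co_am a).1, (H.co_am a).2]; simp

lemma conj_apply (z : R) : H.conj z = am (H.ca z) - am (H.cb z) * x := rfl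
lemma conj_mul (z : R) : z * H.conj z = am (H.nrm z) := by
  rw [conj_apply]
  unfold nrm
  simp only [map_sub, map_mul, map_pow]
  linear_combination (am (H.ca z) - am (H.cb z) * x) * H.eq_co z - am (H.cb z) ^ 2 * H.sq

lemma conj_inj : Function.Injective H.conj := by
  rw [injective_iff_map_eq_zero]
  intro z hz
  by_contra h
  have := H.conj_mul z
  rw [hz, mul_zero] at this
  exact H.am_ne (H.nrm_ne h) this.symm

include H in
lemma int_closed : IsIntegrallyClosed R := by
  let K := FractionRing R
  rw [isIntegrallyClosed_iff K]
  intro y hy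
  have := H.mfin
  have hIntg : Algebra.IsIntegral F[X] R := inferInstance
  have hy' : IsIntegral F[X] y := isIntegral_trans (A := R) y hy
  have hRK : Function.Injective (algebraMap R K) := IsFractionRing.injective R K
  have hinj : Function.Injective (algebraMap F[X] K) := by
    rw [IsScalarTower.algebraMap_eq F[X] R K]
    exact hRK.comp H.am_inj
  obtain ⟨z, w, hw, hydef⟩ := IsFractionRing.div_surjective (A := R) y
  have hw0 : w ≠ 0 := nonZeroDivisors.ne_zero hw
  have hyw : y * algebraMap R K w = algebraMap R K z := by
    rw [← hydef, div_mul_cancel₀]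
    intro h; exact hw0 (hRK (by rw [h, map_zero]))
  let j : R →ₐ[F[X]] K := (IsScalarTower.toAlgHom F[X] R K).comp H.conj
  have hj : Function.Injective j := hRK.comp H.conj_inj
  let σ : K →ₐ[F[X]] K := IsFractionRing.liftAlgHom (K := K) hj
  have hσ : ∀ r : R, σ (algebraMap R K r) = algebraMap R K (H.conj r) := by
    intro r
    exact IsFractionRing.lift_algebraMap hj r
  set n := H.nrm w with hn
  have hn0 : n ≠ 0 := H.nrm_ne hw0
  set c := z * H.conj w with hc
  have hyn : y * algebraMap R K (am n) = algebraMap R K c := by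
    rw [hn, ← H.conj_mul, hc, map_mul, map_mul, ← hyw]; ring
  have hσyn : σ y * algebraMap R K (am n) = algebraMap R K (H.conj c) := by
    have := congrArg σ hyn
    rw [map_mul, hσ, hσ, AlgHom.commutes] at this
    exact this
  have hσy : IsIntegral F[X] (σ y) := hy'.map σ
  have e1 : c = am (H.ca c) + am (H.cb c) * x := H.eq_co c
  have e2 := H.conj_apply c
  obtain ⟨t, ht⟩ := int_frac hinj (2 * H.ca c) n hn0 (y + σ y) (by
    rw [add_mul, IsScalarTower.algebraMap_apply F[X] R K, IsScalarTower.algebraMap_apply F[X] R K (2 * _), hyn, hσyn, ← map_add, e2]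
    congr 1
    rw [map_mul, map_ofNat]
    linear_combination e1) (hy'.add hσy)
  have h2 : (C (2:F)⁻¹ * 2 : F[X]) = 1 := by
    have : (2 : F[X]) = C 2 := (map_ofNat C 2).symm
    rw [this, ← C_mul, inv_mul_cancel₀ H.two, C_1]
  set a0 := C (2:F)⁻¹ * t with ha0
  set s := y - algebraMap F[X] K a0 with hs
  have hsi : IsIntegral F[X] s := hy'.sub isIntegral_algebraMap
  have hta : t * n = 2 * H.ca c := by
    apply hinj
    rw [map_mul, ← ht, add_mul, IsScalarTower.algebraMap_apply F[X] R K, IsScalarTower.algebraMap_apply F[X] R K (2 * _), hyn, hσyn, ← map_add, e2]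
    congr 1
    rw [map_mul, map_ofNat]
    linear_combination e1
  have hca : a0 * n = H.ca c := by
    rw [ha0, mul_assoc, hta, ← mul_assoc, h2, one_mul]
  have hsn : s * algebraMap R K (am n) = algebraMap R K (am (H.cb c) * x) := by
    rw [hs, sub_mul, hyn, IsScalarTower.algebraMap_apply F[X] R K, ← map_mul, ← map_mul, hca, ← map_sub]
    congr 1
    linear_combination e1
  obtain ⟨t2, ht2⟩ := int_frac hinj (H.cb c ^ 2 * f) (n ^ 2) (pow_ne_zero 2 hn0) (s ^ 2) (by
    rw [map_pow, ← mul_pow, IsScalarTower.algebraMap_apply F[X] R K, hsn, IsScalarTower.algebraMap_apply F[X] R K,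
      ← map_pow, mul_pow, H.sq]
    simp only [map_mul, map_pow]) (hsi.pow 2)
  have hdvd : n ^ 2 ∣ H.cb c ^ 2 * f := by
    refine ⟨t2, ?_⟩
    apply hinj
    rw [map_mul _ (n^2), ← ht2, map_pow, mul_comm (_ ^ 2) (s ^ 2), ← mul_pow, IsScalarTower.algebraMap_apply F[X] R K, 
      IsScalarTower.algebraMap_apply F[X] R K, hsn, ← map_pow, mul_pow, H.sq]
    simp only [map_mul, map_pow]
  obtain ⟨b0, hb0⟩ := sq_dvd H.sqf hn0 hdvd
  refine ⟨am a0 + am b0 * x, ?_⟩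
  have hn1 : algebraMap R K (am n) ≠ 0 := by
    rw [← IsScalarTower.algebraMap_apply]
    intro h; exact hn0 (hinj (by rw [h, map_zero]))
  apply mul_right_cancel₀ hn1
  rw [hyn, ← map_mul]
  congr 1
  have h5 : am a0 * am n = am (H.ca c) := by rw [← map_mul, hca]
  have h6 : am (H.cb c) = am n * am b0 := by rw [← map_mul, hb0]
  linear_combination h5 - x * h6 - e1

variable [Finite F]

include H in
lemma dedekind : IsDedekindDomain R := by
  have h1 := H.mfin
  have h2 : IsNoetherianRing R := isNoetherian_of_tower F[X] inferInstance
  have h3 : Ring.DimensionLEOne R := ⟨fun {P} hP hp => by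
    have := H.finite_quot hP
    exact Ideal.Quotient.maximal_of_isField _ (Finite.isField_of_domain (R ⧸ P))⟩
  have h4 := H.int_closed
  have h5 : IsDedekindRing R := { h2, h3 with toIsIntegralClosure := inferInstance }
  exact {}

include H in
lemma infinite : Infinite R := Infinite.of_injective _ H.am_inj

include H in
lemma dg_mul {I J : Ideal R} (hI : I ≠ ⊥) (hJ : J ≠ ⊥) : dg (F := F) (I * J) = dg (F := F) I + dg (F := F) J := by
  have := H.dedekind
  have := H.infinite
  have h := cardQuot_mul' I J
  rw [Submodule.cardQuot_apply, Submodule.cardQuot_apply, Submodule.cardQuot_apply, H.card_quot hI, H.card_quot hJ,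
    H.card_quot (mul_ne_zero hI hJ), ← pow_add] at h
  exact Nat.pow_right_injective (Finite.one_lt_card (α := F)) h

include H in
lemma dg_pos {I : Ideal R} (hI : I ≠ ⊥) (h : I ≠ ⊤) : 0 < dg (F := F) I := by
  by_contra h0
  have := H.card_quot hI
  rw [show dg (F := F) I = 0 by omega, pow_zero] at this
  apply h
  rw [← Submodule.cardQuot_eq_one_iff, Submodule.cardQuot_apply, this]

lemma dg_top : dg (F := F) (⊤ : Ideal R) = 0 := by
  unfold dg
  have : Nat.card (R ⧸ (⊤ : Ideal R)) = 1 := by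
    rw [← Submodule.cardQuot_apply, Submodule.cardQuot_top]
  rw [this]; simp

end HR
end HypE
end

section
open Polynomial nonZeroDivisors

set_option linter.all false

namespace HypE
namespace HR
variable {F : Type*} [Field F] {f : F[X]} {R : Type*} [CommRing R] [IsDomain R] [Algebra F[X] R] {x : R}
  (H : HR f x)

local notation "am" => algebraMap F[X] R

lemma eq_C_of_D {z : R} (hz : z ≠ 0) (hD : H.D z = 0) : ∃ c : F, c ≠ 0 ∧ z = am (C c) := by
  obtain ⟨g, hg⟩ := H.odd
  rcases H.D_cases z with h | h | h
  · exact absurd h hz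
  · obtain ⟨-, -, h1, h2, h3⟩ := h
    have hb : H.cb z = 0 := by
      by_contra hb; have := h3 hb; omega
    have ha : (H.ca z).natDegree = 0 := by omega
    rw [natDegree_eq_zero] at ha
    obtain ⟨c, hc⟩ := ha
    refine ⟨c, ?_, ?_⟩
    · rintro rfl; rw [map_zero] at hc; exact h1 hc.symm
    · rw [hc]; conv_lhs => rw [H.eq_co z]
      rw [hb, map_zero, zero_mul, add_zero]
  · omega

include H in
lemma unit_eq_C {z : R} (hz : IsUnit z) : ∃ c : F, c ≠ 0 ∧ z = am (C c) := by
  apply H.eq_C_of_D hz.ne_zero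
  obtain ⟨w, hw⟩ := hz.exists_right_inv
  have hw0 : w ≠ 0 := by rintro rfl; simp at hw
  have := H.D_mul hz.ne_zero hw0
  rw [hw, H.D_one] at this
  omega

lemma D_C_mul {c : F} (hc : c ≠ 0) {z : R} (hz : z ≠ 0) : H.D (am (C c) * z) = H.D z := by
  rw [H.D_am_mul (C_ne_zero.mpr hc) hz]; simp

variable [Finite F]

/-- ideals of given degree -/
def IdD (F : Type*) [Field F] (R : Type*) [CommRing R] (d : ℕ) : Set ((Ideal R)⁰) :=
  {J | dg (F := F) (J : Ideal R) = d}

include H in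
lemma ne_bot (J : (Ideal R)⁰) : (J : Ideal R) ≠ ⊥ := nonZeroDivisors.coe_ne_zero J

include H in
lemma finite_IdD (d : ℕ) : (IdD F R d).Finite := by
  set m := d + 2 * f.natDegree + 2
  have hfin : Finite (Set (H.Im ⊤ m)) := inferInstance
  have : Function.Injective (fun J : IdD F R d => ({z | z.1 ∈ (J.1 : Ideal R)} : Set (H.Im ⊤ m))) := by
    have key : ∀ J J' : IdD F R d, ({z | z.1 ∈ (J.1 : Ideal R)} : Set (H.Im ⊤ m)) = {z | z.1 ∈ (J'.1 : Ideal R)} →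
        (J.1 : Ideal R) ≤ J'.1 := by
      intro J J' h w hw
      obtain ⟨u, v, hB⟩ := H.exists_bas J.1 (H.ne_bot _)
      have h1 := H.dg_le_D (Bas.umem H hB) hB.u0
      have h2 := H.dg_le_D (Bas.vmem H hB) hB.v0
      have h3 := (H.bas_card hB).2
      have h4 : dg (F := F) (J.1 : Ideal R) = d := J.2
      have hm : ∀ z ∈ (J.1 : Ideal R), H.D z < m → z ∈ (J'.1 : Ideal R) := by
        intro z hz hzm
        have : (⟨z, trivial, H.mem_Rm.mpr (Or.inr hzm)⟩ : H.Im ⊤ m) ∈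
          ({z | z.1 ∈ (J.1 : Ideal R)} : Set (H.Im ⊤ m)) := hz
        rw [h] at this
        exact this
      obtain ⟨a, b, rfl⟩ := (hB.mem w).mp hw
      exact Ideal.add_mem _ (Ideal.mul_mem_left _ _ (hm u (Bas.umem H hB) (by omega)))
        (Ideal.mul_mem_left _ _ (hm v (Bas.vmem H hB) (by omega)))
    intro J J' h
    exact Subtype.ext (Subtype.ext (le_antisymm (key J J' h) (key J' J h.symm)))
  exact Finite.of_injective _ this

/-- ideals of given degree and class -/
def IdC (F : Type*) [Field F] {R : Type*} [CommRing R] [IsDomain R] [IsDedekindDomain R]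
    (c : ClassGroup R) (d : ℕ) : Set ((Ideal R)⁰) :=
  {J | ClassGroup.mk0 J = c ∧ dg (F := F) (J : Ideal R) = d}

variable [IsDedekindDomain R]

include H in
lemma finite_IdC (c : ClassGroup R) (d : ℕ) : (IdC F c d).Finite :=
  (H.finite_IdD d).subset fun _ h => h.2

lemma count_step (c : ClassGroup R) (I : (Ideal R)⁰) (hI : ClassGroup.mk0 I = c⁻¹) (d : ℕ) :
    Nat.card (H.Im (I : Ideal R) (dg (F := F) (I : Ideal R) + d + 1)) =
      Nat.card (H.Im (I : Ideal R) (dg (F := F) (I : Ideal R) + d)) + (IdC F c d).ncard * (Nat.card F - 1) := by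
  set δ := dg (F := F) (I : Ideal R) with hδ
  have hI0 := H.ne_bot I
  -- generators
  have hgen : ∀ J : IdC F c d, ∃ z : R, (I : Ideal R) * (J.1 : Ideal R) = Ideal.span {z} := by
    intro J
    have h1 : ClassGroup.mk0 (I * J.1) = 1 := by rw [map_mul, hI, J.2.1, inv_mul_cancel]
    rw [ClassGroup.mk0_eq_one_iff (I * J.1).2] at h1
    obtain ⟨z, hz⟩ := h1
    exact ⟨z, hz⟩
  choose gen hgen using hgen
  have hgen0 : ∀ J, gen J ≠ 0 := by
    intro J h
    have := hgen J
    rw [h, Ideal.span_singleton_eq_bot.mpr rfl] at this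
    exact mul_ne_zero hI0 (H.ne_bot J.1) this
  have hgenD : ∀ J, H.D (gen J) = δ + d := by
    intro J
    rw [← H.dg_span (hgen0 J), ← hgen, H.dg_mul hI0 (H.ne_bot _), J.2.2]
  set A : Set R := {z | z ∈ (I : Ideal R) ∧ z ≠ 0 ∧ H.D z = δ + d} with hA
  have hbij : Nat.card A = (IdC F c d).ncard * (Nat.card F - 1) := by
    have e : Nat.card Fˣ = Nat.card F - 1 := Nat.card_units F
    rw [← e, ← Nat.card_coe_set_eq, ← Nat.card_prod]
    symm
    apply Nat.card_congr
    have hmemA : ∀ (J : IdC F c d) (b : Fˣ), am (C (b : F)) * gen J ∈ A := by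
      intro J b
      refine ⟨?_, ?_, ?_⟩
      · apply Ideal.mul_mem_left
        have : gen J ∈ (I : Ideal R) * (J.1 : Ideal R) := by
          rw [hgen]; exact Ideal.mem_span_singleton_self _
        exact Ideal.mul_le_left this
      · exact mul_ne_zero (H.am_ne (C_ne_zero.mpr b.ne_zero)) (hgen0 _)
      · rw [H.D_C_mul b.ne_zero (hgen0 _), hgenD]
    let φ : IdC F c d × Fˣ → A := fun Jc => ⟨am (C (Jc.2 : F)) * gen Jc.1, hmemA _ _⟩
    refine Equiv.ofBijective φ ⟨?_, ?_⟩
    · rintro ⟨J, a⟩ ⟨J', a'⟩ h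
      have h : am (C (a : F)) * gen J = am (C (a' : F)) * gen J' := congrArg Subtype.val h
      have hu : ∀ b : Fˣ, IsUnit (am (C (b : F))) := fun b => ((b.isUnit.map C).map am)
      have h1 : Ideal.span {gen J} = Ideal.span {gen J'} := by
        rw [← Ideal.span_singleton_mul_left_unit (hu a), h, Ideal.span_singleton_mul_left_unit (hu a')]
      rw [← hgen, ← hgen] at h1
      have h2 : (J.1 : Ideal R) = J'.1 := mul_left_cancel₀ hI0 h1
      have h3 : J = J' := Subtype.ext (Subtype.ext h2)
      subst h3
      have h4 := mul_right_cancel₀ (hgen0 J) h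
      have h5 := C_injective (H.am_inj h4)
      rw [Units.ext h5]
    · rintro ⟨z, hz, hz0, hzD⟩
      have hdvd : (I : Ideal R) ∣ Ideal.span {z} := by
        rw [Ideal.dvd_iff_le, Ideal.span_singleton_le_iff_mem]; exact hz
      obtain ⟨J, hJ⟩ := hdvd
      have hsz : Ideal.span {z} ≠ ⊥ := by simpa using hz0
      have hJ0 : J ≠ ⊥ := by rintro rfl; rw [Ideal.mul_bot] at hJ; exact hsz hJ
      have hJn : J ∈ (Ideal R)⁰ := mem_nonZeroDivisors_of_ne_zero hJ0
      have hJm : (⟨J, hJn⟩ : (Ideal R)⁰) ∈ IdC F c d := by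
        refine ⟨?_, ?_⟩
        · have : ClassGroup.mk0 (I * ⟨J, hJn⟩) = 1 := by
            rw [ClassGroup.mk0_eq_one_iff (I * ⟨J, hJn⟩).2]
            exact ⟨z, hJ.symm⟩
          rw [map_mul, hI] at this
          exact (inv_mul_eq_one.mp this).symm
        · have := H.dg_mul hI0 hJ0
          rw [← hJ, H.dg_span hz0, hzD] at this
          change dg (F := F) J = d
          omega
      have hs : Ideal.span {gen ⟨⟨J, hJn⟩, hJm⟩} = Ideal.span {z} := by rw [← hgen, hJ]
      rw [Ideal.span_singleton_eq_span_singleton] at hs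
      obtain ⟨w, hw⟩ := hs
      obtain ⟨a, ha, hwa⟩ := H.unit_eq_C w.isUnit
      refine ⟨⟨⟨⟨J, hJn⟩, hJm⟩, Units.mk0 a ha⟩, Subtype.ext ?_⟩
      change am (C a) * _ = z
      rw [← hwa, ← hw, mul_comm]
  rw [← hbij]
  have hd : Disjoint (H.Im (I : Ideal R) (δ + d) : Set R) A := by
    rw [Set.disjoint_left]
    rintro z hz ⟨_, h0, h1⟩
    rcases H.mem_Rm.mp hz.2 with h | h
    · exact h0 h
    · omega
  have hu : (H.Im (I : Ideal R) (δ + d + 1) : Set R) = (H.Im (I : Ideal R) (δ + d) : Set R) ∪ A := by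
    ext z
    simp only [SetLike.mem_coe, mem_Im, Set.mem_union, hA, Set.mem_setOf_eq, mem_Rm]
    constructor
    · rintro ⟨h1, h2⟩
      by_cases h0 : z = 0
      · left; exact ⟨h1, Or.inl h0⟩
      rcases h2 with h2 | h2
      · exact absurd h2 h0
      rcases Nat.lt_succ_iff_lt_or_eq.mp h2 with h3 | h3
      · left; exact ⟨h1, Or.inr h3⟩
      · right; exact ⟨h1, h0, h3⟩
    · rintro (⟨h1, h2⟩ | ⟨h1, h2, h3⟩)
      · refine ⟨h1, ?_⟩
        rcases h2 with h2 | h2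
        · exact Or.inl h2
        · right; omega
      · exact ⟨h1, Or.inr (by omega)⟩
  have hf1 : (H.Im (I : Ideal R) (δ + d) : Set R).Finite := H.finite_Im _ _
  have hf2 : A.Finite := by
    have : (H.Im (I : Ideal R) (δ + d + 1) : Set R).Finite := H.finite_Im _ _
    rw [hu] at this
    exact this.subset Set.subset_union_right
  have := Set.ncard_union_eq hd hf1 hf2
  rw [← hu] at this
  rw [Nat.card_coe_set_eq]
  exact this

omit [Finite F] in
lemma exists_rep (c : ClassGroup R) : ∃ I : (Ideal R)⁰, ClassGroup.mk0 I = c :=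
  ClassGroup.mk0_surjective c

include H in
/-- number of ideals of large degree in a class -/
lemma ncard_IdC (c : ClassGroup R) (d : ℕ) (hd : 2 * (f.natDegree / 2) ≤ d) :
    (IdC F c d).ncard = Nat.card F ^ (d - f.natDegree / 2) := by
  obtain ⟨I, hI⟩ := exists_rep c⁻¹
  have h := H.count_step c I hI d
  have hq : 1 < Nat.card F := Finite.one_lt_card
  rw [H.card_Im_large (H.ne_bot I) _ (by omega), H.card_Im_large (H.ne_bot I) _ (by omega)] at h
  set δ := dg (F := F) (I : Ideal R)
  rw [show δ + d + 1 - δ - f.natDegree / 2 = (d - f.natDegree / 2) + 1 by omega,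
    show δ + d - δ - f.natDegree / 2 = (d - f.natDegree / 2) by omega, pow_succ] at h
  obtain ⟨q, hq'⟩ : ∃ q, Nat.card F = q + 2 := ⟨Nat.card F - 2, by omega⟩
  rw [hq'] at h ⊢
  rw [show q + 2 - 1 = q + 1 by omega] at h
  have : (q + 1) * (IdC F c d).ncard = (q + 1) * (q + 2) ^ (d - f.natDegree / 2) := by linarith
  exact Nat.eq_of_mul_eq_mul_left (by omega) this

include H in
/-- number of ideals of small degree in a class -/
lemma sum_IdC (c : ClassGroup R) :
    (∑ d ∈ Finset.range (2 * (f.natDegree / 2)), (IdC F c d).ncard) * (Nat.card F - 1) + 1 =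
      Nat.card F ^ (f.natDegree / 2) := by
  obtain ⟨I, hI⟩ := exists_rep c⁻¹
  set δ := dg (F := F) (I : Ideal R) with hδ
  have h1 : ∀ n, (∑ d ∈ Finset.range n, (IdC F c d).ncard) * (Nat.card F - 1) + 1 =
      Nat.card (H.Im (I : Ideal R) (δ + n)) := by
    intro n
    induction n with
    | zero =>
      have : Subsingleton (H.Im (I : Ideal R) δ) := by
        constructor
        intro a b
        apply Subtype.ext
        rw [H.Im_small a.1 a.2, H.Im_small b.1 b.2]
      simp only [Finset.range_zero, Finset.sum_empty, zero_mul, zero_add, add_zero]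
      rw [Nat.card_unique]
    | succ n ih =>
      rw [Finset.sum_range_succ, add_mul, ← add_assoc, H.count_step c I hI n, ← ih]
      ring
  rw [h1, H.card_Im_large (H.ne_bot I) _ (by omega)]
  congr 1
  omega

include H in
lemma finite_class : Finite (ClassGroup R) := by
  have := (H.finite_IdD (2 * (f.natDegree / 2))).to_subtype
  apply Finite.of_surjective (fun J : IdD F R (2 * (f.natDegree / 2)) => ClassGroup.mk0 J.1)
  intro c
  have h := H.ncard_IdC c (2 * (f.natDegree / 2)) le_rfl
  have hq : 1 < Nat.card F := Finite.one_lt_card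
  have h2 : (IdC F c (2 * (f.natDegree / 2))).Nonempty := by
    apply Set.nonempty_of_ncard_ne_zero
    rw [h]; exact pow_ne_zero _ (by omega)
  obtain ⟨J, hJ⟩ := h2
  exact ⟨⟨J, hJ.2⟩, hJ.1⟩

end HR
end HypE
end

section
open Polynomial nonZeroDivisors

set_option linter.all false

namespace HypE
namespace HR
variable {F : Type*} [Field F] {f : F[X]} {R : Type*} [CommRing R] [IsDomain R] [Algebra F[X] R] {x : R}
  (H : HR f x)

local notation "am" => algebraMap F[X] R

variable [Finite F] [IsDedekindDomain R]

include H in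
lemma finite_IdI (d : ℕ) : {J : Ideal R | J ≠ ⊥ ∧ dg (F := F) J = d}.Finite := by
  refine ((H.finite_IdD d).image (fun J : (Ideal R)⁰ => (J : Ideal R))).subset ?_
  rintro J ⟨h1, h2⟩
  exact ⟨⟨J, mem_nonZeroDivisors_of_ne_zero h1⟩, h2, rfl⟩

/-- the finset of ideals of degree `d` -/
noncomputable def ids (d : ℕ) : Finset (Ideal R) := (H.finite_IdI d).toFinset

lemma mem_ids {d : ℕ} {J : Ideal R} : J ∈ H.ids d ↔ J ≠ ⊥ ∧ dg (F := F) J = d := by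
  unfold ids; rw [Set.Finite.mem_toFinset]; rfl

open Classical in
/-- von Mangoldt function -/
noncomputable def vM (F : Type*) [Field F] {R : Type*} [CommRing R] (Q : Ideal R) : ℕ :=
  if h : IsPrimePow Q then dg (F := F) h.choose else 0

omit [IsDomain R] [Algebra F[X] R] [Finite F] in
lemma prime_pow_unique {P P' : Ideal R} {k k' : ℕ} (hP : Prime P) (hP' : Prime P') (hk : 0 < k)
    (h : P ^ k = P' ^ k') : P = P' := by
  have h1 : P ∣ P' ^ k' := by rw [← h]; exact dvd_pow_self P hk.ne'
  exact associated_iff_eq.mp (hP.associated_of_dvd hP' (hP.dvd_of_dvd_pow h1))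

omit [IsDomain R] [Algebra F[X] R] [Finite F] in
lemma vM_pow {P : Ideal R} (hP : Prime P) {k : ℕ} (hk : 0 < k) : vM F (P ^ k) = dg (F := F) P := by
  have h : IsPrimePow (P ^ k) := ⟨P, k, hP, hk, rfl⟩
  unfold vM
  rw [dif_pos h]
  obtain ⟨k', h1, h2, h3⟩ := h.choose_spec
  rw [prime_pow_unique h1 hP h2 h3]

omit [IsDomain R] [Algebra F[X] R] [Finite F] [IsDedekindDomain R] in
lemma vM_zero {Q : Ideal R} (hQ : ¬ IsPrimePow Q) : vM F Q = 0 := by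
  unfold vM; rw [dif_neg hQ]

include H in
lemma dg_multiset (s : Multiset (Ideal R)) (hs : ∀ P ∈ s, P ≠ ⊥) :
    dg (F := F) s.prod = (s.map (dg (F := F))).sum := by
  induction s using Multiset.induction_on with
  | empty => simp only [Multiset.prod_zero, Multiset.map_zero, Multiset.sum_zero, Ideal.one_eq_top, dg_top]
  | cons a s ih =>
    rw [Multiset.prod_cons, Multiset.map_cons, Multiset.sum_cons, ← ih (fun P hP => hs P (by simp [hP])), H.dg_mul (hs a (by simp))]
    apply Multiset.prod_ne_zero
    intro h0
    exact hs ⊥ (Multiset.mem_cons_of_mem h0) rfl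

include H in
lemma dg_pow {P : Ideal R} (hP : P ≠ ⊥) (k : ℕ) : dg (F := F) (P ^ k) = k * dg (F := F) P := by
  induction k with
  | zero => rw [pow_zero, Ideal.one_eq_top, dg_top, zero_mul]
  | succ k ih => rw [pow_succ, H.dg_mul (pow_ne_zero k hP) hP, ih]; ring

open Classical in
lemma vM_sum {J : Ideal R} (hJ : J ≠ ⊥) (d : ℕ) (hd : dg (F := F) J = d)  :
    ∑ s ∈ ((Finset.HasAntidiagonal.antidiagonal d).sigma
      (fun ij => H.ids ij.1 ×ˢ H.ids ij.2)).filter (fun s => s.2.1 * s.2.2 = J), vM F s.2.1 = d := by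
  set nf := UniqueFactorizationMonoid.normalizedFactors J with hnf
  have hprime : ∀ P ∈ nf, Prime P := fun P hP => UniqueFactorizationMonoid.prime_of_normalized_factor P hP
  have hprod : nf.prod = J := Ideal.prod_normalizedFactors_eq_self hJ
  have h1 : d = ∑ s ∈ nf.toFinset.sigma (fun P => Finset.range (nf.count P)), dg (F := F) s.1 := by
    rw [← hd, ← hprod, H.dg_multiset nf (fun P hP => (hprime P hP).ne_zero), Finset.sum_multiset_map_count,
      Finset.sum_sigma]
    simp
  let cof : Ideal R → Ideal R := fun Q => if h : Q ∣ J then h.choose else 1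
  have hcof : ∀ Q, Q ∣ J → Q * cof Q = J := by
    intro Q h
    simp only [cof, dif_pos h]
    exact h.choose_spec.symm
  have hdvd : ∀ s ∈ nf.toFinset.sigma (fun P => Finset.range (nf.count P)), Prime s.1 ∧ s.1 ^ (s.2 + 1) ∣ J := by
    rintro ⟨P, k⟩ hs
    rw [Finset.mem_sigma, Multiset.mem_toFinset, Finset.mem_range] at hs
    refine ⟨hprime P hs.1, ?_⟩
    have : Multiset.replicate (k + 1) P ≤ nf := Multiset.le_count_iff_replicate_le.mp hs.2
    have := Multiset.prod_dvd_prod_of_le this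
    rwa [Multiset.prod_replicate, hprod] at this
  conv_rhs => rw [h1]
  symm
  refine Finset.sum_of_injOn (fun s => ⟨(dg (F := F) (s.1 ^ (s.2 + 1)), dg (F := F) (cof (s.1 ^ (s.2 + 1)))),
    (s.1 ^ (s.2 + 1), cof (s.1 ^ (s.2 + 1)))⟩) ?_ ?_ ?_ ?_
  · rintro ⟨P, k⟩ hs ⟨P', k'⟩ hs' h
    have hP := hdvd _ hs
    have hP' := hdvd _ hs'
    have h : P ^ (k + 1) = P' ^ (k' + 1) := congrArg (fun t : (_ : ℕ × ℕ) × (Ideal R × Ideal R) => t.2.1) h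
    have e := prime_pow_unique hP.1 hP'.1 (Nat.succ_pos k) h
    subst e
    have h2 := congrArg (dg (F := F)) h
    rw [H.dg_pow hP.1.ne_zero, H.dg_pow hP.1.ne_zero] at h2
    have h3 : 0 < dg (F := F) P := H.dg_pos hP.1.ne_zero (fun h : P = ⊤ => hP.1.not_unit (by change IsUnit P; rw [h, ← Ideal.one_eq_top]; exact isUnit_one))
    have h4 := Nat.eq_of_mul_eq_mul_right h3 h2
    have h5 : k = k' := by omega
    rw [h5]
  · intro s hs
    obtain ⟨hP, hPJ⟩ := hdvd s hs
    have h2 := hcof _ hPJ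
    have h3 : s.1 ^ (s.2 + 1) ≠ ⊥ := pow_ne_zero _ hP.ne_zero
    have h4 : cof (s.1 ^ (s.2 + 1)) ≠ ⊥ := by
      intro h; rw [h, Ideal.mul_bot] at h2; exact hJ h2.symm
    simp only [Finset.coe_filter, Set.mem_setOf_eq, Finset.mem_sigma, Finset.mem_product, mem_ids,
      Finset.HasAntidiagonal.mem_antidiagonal]
    refine ⟨⟨?_, ⟨h3, trivial⟩, h4, trivial⟩, h2⟩
    rw [← H.dg_mul h3 h4, h2, hd]
  · rintro ⟨⟨i, j⟩, Q, J'⟩ ht hn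
    simp only [Finset.mem_filter, Finset.mem_sigma, Finset.mem_product, mem_ids,
      Finset.HasAntidiagonal.mem_antidiagonal] at ht
    obtain ⟨⟨hij, ⟨hQ, hQi⟩, hJ', hJj⟩, hQJ⟩ := ht
    apply vM_zero
    rintro ⟨P, k, hP, hk, hPk⟩
    change P ^ k = Q at hPk
    apply hn
    have hQd : Q ∣ J := ⟨J', hQJ.symm⟩
    have hce : cof Q = J' := by
      apply mul_left_cancel₀ hQ
      rw [hcof Q hQd, hQJ]
    refine ⟨⟨P, k - 1⟩, ?_, ?_⟩
    · have : Multiset.replicate k P ≤ nf := by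
        rw [← hPk, UniqueFactorizationMonoid.dvd_iff_normalizedFactors_le_normalizedFactors (by rw [hPk]; exact hQ) hJ,
          UniqueFactorizationMonoid.normalizedFactors_pow, UniqueFactorizationMonoid.normalizedFactors_irreducible hP.irreducible,
          normalize_eq, Multiset.nsmul_singleton] at hQd
        exact hQd
      have h2 := Multiset.le_count_iff_replicate_le.mpr this
      have h2' : k - 1 < nf.count P := by omega
      simp only [Finset.coe_sigma, Set.mem_sigma_iff, Finset.mem_coe, Multiset.mem_toFinset, Finset.mem_range]
      exact ⟨Multiset.count_pos.mp (by omega), h2'⟩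
    · have e : k - 1 + 1 = k := by omega
      simp only [e, hPk, hce, hQi, hJj]
  · intro s hs
    exact (vM_pow (hdvd s hs).1 (Nat.succ_pos _)).symm

variable {Fo : Type*} [Field Fo]

/-- coefficients of the L-function -/
noncomputable def cX (X : Ideal R → Fo) (d : ℕ) : Fo := ∑ J ∈ H.ids d, X J
/-- power sums -/
noncomputable def aX (X : Ideal R → Fo) (m : ℕ) : Fo := ∑ Q ∈ H.ids m, (vM F Q : Fo) * X Q

lemma ids_zero : H.ids 0 = {⊤} := by
  ext J
  rw [mem_ids, Finset.mem_singleton]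
  constructor
  · rintro ⟨h1, h2⟩
    by_contra h
    have := H.dg_pos h1 h; omega
  · rintro rfl
    exact ⟨top_ne_bot, dg_top⟩

lemma cX_zero (X : Ideal R → Fo) (h1 : X ⊤ = 1) : H.cX X 0 = 1 := by
  unfold cX; rw [ids_zero]; simp [h1]

lemma aX_zero (X : Ideal R → Fo) : H.aX X 0 = 0 := by
  unfold aX; rw [ids_zero]; simp only [Finset.sum_singleton]
  rw [vM_zero, Nat.cast_zero, zero_mul]
  intro h
  exact h.not_unit (by rw [← Ideal.one_eq_top]; exact isUnit_one)

/-- the logarithmic derivative of the L-function -/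
theorem LD_L (X : Ideal R → Fo) (hX : ∀ I J, I ≠ ⊥ → J ≠ ⊥ → X (I * J) = X I * X J) :
    LD (PowerSeries.mk (H.cX X)) (H.aX X) := by
  classical
  intro d
  have e1 : ∀ ij : ℕ × ℕ, (if ij.1 = 0 then 0 else H.aX X ij.1) = H.aX X ij.1 := by
    intro ij; split_ifs with h
    · rw [h, aX_zero]
    · rfl
  simp only [e1, PowerSeries.coeff_mk]
  have e2 : ∑ ij ∈ Finset.HasAntidiagonal.antidiagonal d, H.aX X ij.1 * H.cX X ij.2 =
      ∑ s ∈ (Finset.HasAntidiagonal.antidiagonal d).sigma (fun ij => H.ids ij.1 ×ˢ H.ids ij.2),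
        (vM F s.2.1 : Fo) * X (s.2.1 * s.2.2) := by
    rw [Finset.sum_sigma]
    refine Finset.sum_congr rfl fun ij _ => ?_
    unfold aX cX
    rw [Finset.sum_mul_sum, Finset.sum_product]
    refine Finset.sum_congr rfl fun Q hQ => Finset.sum_congr rfl fun J hJ => ?_
    rw [hX Q J (H.mem_ids.mp hQ).1 (H.mem_ids.mp hJ).1, mul_assoc]
  rw [e2, ← Finset.sum_fiberwise_of_maps_to (t := H.ids d) (g := fun s => s.2.1 * s.2.2)]
  · unfold cX
    rw [Finset.mul_sum]
    refine Finset.sum_congr rfl fun J hJ => ?_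
    rw [mem_ids] at hJ
    have := H.vM_sum hJ.1 d hJ.2
    conv_lhs => rw [← this]
    rw [Nat.cast_sum, Finset.sum_mul]
    refine Finset.sum_congr rfl fun s hs => ?_
    rw [(Finset.mem_filter.mp hs).2]
  · rintro ⟨⟨i, j⟩, Q, J⟩ hs
    simp only [Finset.mem_sigma, Finset.mem_product, mem_ids,
      Finset.HasAntidiagonal.mem_antidiagonal] at hs ⊢
    refine ⟨mul_ne_zero hs.2.1.1 hs.2.2.1, ?_⟩
    rw [H.dg_mul hs.2.1.1 hs.2.2.1, hs.2.1.2, hs.2.2.2, hs.1]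

open Classical in
/-- class of an ideal -/
noncomputable def cl (J : Ideal R) : ClassGroup R :=
  if h : J ∈ (Ideal R)⁰ then ClassGroup.mk0 ⟨J, h⟩ else 1

omit [IsDomain R] in
lemma cl_of [IsDomain R] {J : Ideal R} (h : J ≠ ⊥) : cl J = ClassGroup.mk0 ⟨J, mem_nonZeroDivisors_of_ne_zero h⟩ := by
  unfold cl; rw [dif_pos (mem_nonZeroDivisors_of_ne_zero h)]

lemma cl_mul {I J : Ideal R} (hI : I ≠ ⊥) (hJ : J ≠ ⊥) : cl (I * J) = cl I * cl J := by
  rw [cl_of hI, cl_of hJ, cl_of (mul_ne_zero hI hJ), ← map_mul]; rfl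

lemma cl_top : cl (⊤ : Ideal R) = 1 := by
  rw [cl_of top_ne_bot, ← map_one ClassGroup.mk0]; congr 1; exact Subtype.ext Ideal.one_eq_top.symm

lemma cl_pow {I : Ideal R} (hI : I ≠ ⊥) (k : ℕ) : cl (I ^ k) = cl I ^ k := by
  induction k with
  | zero => rw [pow_zero, pow_zero, Ideal.one_eq_top, cl_top]
  | succ k ih => rw [pow_succ, pow_succ, cl_mul (pow_ne_zero k hI) hI, ih]

lemma cX_class [Fintype (ClassGroup R)] (χ : ClassGroup R → Fo) (d : ℕ) :
    H.cX (fun J => χ (cl J)) d = ∑ c : ClassGroup R, ((IdC F c d).ncard : Fo) * χ c := by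
  classical
  unfold cX
  rw [← Finset.sum_fiberwise_of_maps_to (t := Finset.univ) (g := fun J => cl J) (fun _ _ => Finset.mem_univ _)]
  refine Finset.sum_congr rfl fun c _ => ?_
  rw [Finset.sum_congr rfl (g := fun _ => χ c) (fun J hJ => by rw [(Finset.mem_filter.mp hJ).2]), Finset.sum_const,
    nsmul_eq_mul]
  congr 2
  rw [← Set.ncard_coe_finset]
  rw [← Set.ncard_image_of_injective (f := fun J : (Ideal R)⁰ => (J : Ideal R)) _ Subtype.val_injective]
  congr 1
  ext J
  simp only [Finset.coe_filter, Set.mem_setOf_eq, Set.mem_image, mem_ids]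
  constructor
  · rintro ⟨⟨h1, h2⟩, h3⟩
    refine ⟨⟨J, mem_nonZeroDivisors_of_ne_zero h1⟩, ⟨?_, h2⟩, rfl⟩
    rw [← cl_of h1, h3]
  · rintro ⟨J, ⟨h1, h2⟩, rfl⟩
    exact ⟨⟨H.ne_bot J, h2⟩, by rw [cl_of (H.ne_bot J)]; exact h1⟩

lemma cX_one_large [Fintype (ClassGroup R)] (d : ℕ) (hd : 2 * (f.natDegree / 2) ≤ d) :
    H.cX (fun _ => (1 : Fo)) d = Nat.card (ClassGroup R) * (Nat.card F : Fo) ^ (d - f.natDegree / 2) := by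
  have := H.cX_class (fun _ => (1 : Fo)) d
  rw [this, Finset.sum_congr rfl (fun c _ => by rw [H.ncard_IdC c d hd])]
  simp [Nat.card_eq_fintype_card]

lemma cX_char_large (χ : ClassGroup R →* Fo) (hχ : χ ≠ 1) (d : ℕ) (hd : 2 * (f.natDegree / 2) ≤ d) :
    H.cX (fun J => χ (cl J)) d = 0 := by
  have := H.finite_class
  have := Fintype.ofFinite (ClassGroup R)
  rw [H.cX_class χ d, Finset.sum_congr rfl (fun c _ => by rw [H.ncard_IdC c d hd]), ← Finset.mul_sum,
    sum_hom_units_eq_zero χ hχ, mul_zero]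

lemma cX_one_sum [Fintype (ClassGroup R)] :
    (∑ d ∈ Finset.range (2 * (f.natDegree / 2)), H.cX (fun _ => (1 : Fo)) d) * ((Nat.card F : Fo) - 1) +
      Nat.card (ClassGroup R) = Nat.card (ClassGroup R) * (Nat.card F : Fo) ^ (f.natDegree / 2) := by
  have h1 := fun d => H.cX_class (fun _ => (1 : Fo)) d
  simp only [h1, mul_one]
  rw [Finset.sum_comm, Finset.sum_mul]
  have e : (Nat.card (ClassGroup R) : Fo) = ∑ c : ClassGroup R, 1 := by simp [Nat.card_eq_fintype_card]
  rw [e, Finset.sum_mul, ← Finset.sum_add_distrib]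
  refine Finset.sum_congr rfl fun c _ => ?_
  have := congrArg (Nat.cast (R := Fo)) (H.sum_IdC c)
  have hq : 1 ≤ Nat.card F := Nat.card_pos
  push_cast [Nat.cast_sub hq] at this
  rw [this, one_mul]

/-- the L-polynomial -/
theorem exists_P : ∃ P : Fo[X], P.coeff 0 = 1 ∧ P.eval 1 = Nat.card (ClassGroup R) ∧
    (P : PowerSeries Fo) = (1 - PowerSeries.C (Nat.card F : Fo) * PowerSeries.X) * PowerSeries.mk (H.cX (fun _ => (1 : Fo))) ∧
    LD (P : PowerSeries Fo) (fun m => - (Nat.card F : Fo) ^ m + H.aX (fun _ => (1 : Fo)) m) := by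
  have := H.finite_class
  have := Fintype.ofFinite (ClassGroup R)
  set c := H.cX (fun _ => (1 : Fo)) with hc
  set q : Fo := (Nat.card F : Fo) with hq
  set Z := PowerSeries.mk c with hZ
  set g := f.natDegree / 2 with hg
  set W := (1 - PowerSeries.C q * PowerSeries.X) * Z with hW
  have hW0 : PowerSeries.coeff 0 W = 1 := by
    rw [hW, sub_mul, one_mul, mul_assoc, map_sub, PowerSeries.coeff_C_mul, PowerSeries.coeff_zero_X_mul, mul_zero,
      sub_zero, hZ, PowerSeries.coeff_mk, hc, H.cX_zero _ rfl]
  have hWs : ∀ d, PowerSeries.coeff (d + 1) W = c (d + 1) - q * c d := by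
    intro d
    rw [hW, sub_mul, one_mul, mul_assoc, map_sub, PowerSeries.coeff_C_mul, PowerSeries.coeff_succ_X_mul,
      hZ, PowerSeries.coeff_mk, PowerSeries.coeff_mk]
  have hP : ((PowerSeries.trunc (2 * g + 1) W : Fo[X]) : PowerSeries Fo) = W := by
    ext d
    rw [Polynomial.coeff_coe, PowerSeries.coeff_trunc]
    split_ifs with h
    · rfl
    · obtain ⟨e, rfl⟩ : ∃ e, d = e + 1 := ⟨d - 1, by omega⟩
      rw [hWs, hc, H.cX_one_large _ (by omega), H.cX_one_large _ (by omega), ← hg,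
        show e + 1 - g = e - g + 1 by omega, pow_succ]
      ring
  refine ⟨PowerSeries.trunc (2 * g + 1) W, ?_, ?_, hP, ?_⟩
  · rw [PowerSeries.coeff_trunc, if_pos (by omega), hW0]
  · have key : ∀ n, (PowerSeries.trunc (n + 1) W).eval 1 + (∑ d ∈ Finset.range n, c d) * (q - 1) = c n := by
      intro n
      induction n with
      | zero =>
        rw [zero_add, PowerSeries.trunc_one_left, eval_C]
        simp only [Finset.range_zero, Finset.sum_empty, zero_mul, add_zero]
        rw [hc, H.cX_zero _ rfl]
        exact hW0
      | succ n ih =>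
        rw [PowerSeries.trunc_succ, eval_add, eval_monomial, one_pow, mul_one, hWs, Finset.sum_range_succ]
        linear_combination ih
    have h1 := key (2 * g)
    have h2 := H.cX_one_sum (Fo := Fo)
    rw [← hc, ← hq, ← hg] at h2
    rw [hc, H.cX_one_large _ (by omega), ← hc, ← hq, ← hg, show 2 * g - g = g by omega] at h1
    linear_combination h1 - h2
  · rw [hP, hW]
    exact LD.mul (LD_linear q) (H.LD_L _ (fun _ _ _ _ => (mul_one _).symm))

end HR
end HypE
end

section
open Polynomial nonZeroDivisors

set_option linter.all false

namespace HypE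
namespace HR
variable {F : Type*} [Field F] {f : F[X]} {R : Type*} [CommRing R] [IsDomain R] [Algebra F[X] R] {x : R}
  (H : HR f x)

local notation "am" => algebraMap F[X] R

section pts
variable [Algebra F R] [IsScalarTower F F[X] R] {E : Type*} [Field E] [Algebra F E]

/-- affine points -/
def pts (f : F[X]) (E : Type*) [Field E] [Algebra F E] : Set (E × E) := {t | t.2 ^ 2 = aeval t.1 f}

/-- evaluation at a point -/
noncomputable def evalPt (t : E × E) (ht : t ∈ pts f E) : R →ₐ[F] E where
  toFun z := aeval t.1 (H.ca z) + aeval t.1 (H.cb z) * t.2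
  map_one' := by
    have := H.co_am 1
    rw [map_one] at this
    rw [this.1, this.2]; simp
  map_zero' := by rw [H.co_zero.1, H.co_zero.2]; simp
  map_add' z w := by rw [ca_add, cb_add]; simp only [map_add]; ring
  map_mul' z w := by
    rw [(H.co_mul z w).1, (H.co_mul z w).2]; simp only [map_add, map_mul]
    have ht : t.2 ^ 2 = aeval t.1 f := ht
    rw [← ht]; ring
  commutes' c := by
    have : algebraMap F R c = am (C c) := by
      rw [IsScalarTower.algebraMap_apply F F[X] R]; rfl
    rw [this, (H.co_am _).1, (H.co_am _).2]; simp

include H in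
omit [IsDomain R] in
lemma hom_equiv : Nonempty ((R →ₐ[F] E) ≃ pts f E) := by
  have key : ∀ (φ : R →ₐ[F] E) (a : F[X]), φ (am a) = aeval (φ (am X)) a := by
    intro φ a
    have : (φ.comp (IsScalarTower.toAlgHom F F[X] R)) = aeval (φ (am X)) := by
      ext; simp
    have h2 := congrArg (fun ψ : F[X] →ₐ[F] E => ψ a) this
    simpa using h2
  have hmem : ∀ φ : R →ₐ[F] E, (φ (am X), φ x) ∈ pts f E := by
    intro φ
    change (φ x) ^ 2 = aeval (φ (am X)) f
    rw [← map_pow, H.sq, key]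
  let Φ : (R →ₐ[F] E) → pts f E := fun φ => ⟨(φ (am X), φ x), hmem φ⟩
  refine ⟨Equiv.ofBijective Φ ⟨?_, ?_⟩⟩
  · intro φ ψ h
    have h1 : φ (am X) = ψ (am X) := congrArg (fun t => t.1.1) h
    have h2 : φ x = ψ x := congrArg (fun t => t.1.2) h
    ext z
    rw [H.eq_co z, map_add, map_add, map_mul, map_mul, key φ (H.ca z), key φ (H.cb z), key ψ (H.ca z), key ψ (H.cb z), h1, h2]
  · rintro ⟨t, ht⟩
    refine ⟨H.evalPt t ht, ?_⟩
    apply Subtype.ext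
    apply Prod.ext
    · change aeval t.1 (H.ca (am X)) + aeval t.1 (H.cb (am X)) * t.2 = t.1
      rw [(H.co_am _).1, (H.co_am _).2]; simp
    · change aeval t.1 (H.ca x) + aeval t.1 (H.cb x) * t.2 = t.2
      rw [H.co_x.1, H.co_x.2]; simp

include H in
omit [IsDomain R] in
lemma card_hom : Nat.card (R →ₐ[F] E) = (pts f E).ncard := by
  rw [← Nat.card_coe_set_eq]
  obtain ⟨e⟩ := H.hom_equiv (E := E)
  exact Nat.card_congr e

variable [Finite F] [IsDedekindDomain R]

include H in
omit [IsDedekindDomain R] in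
lemma finrank_quot {P : Ideal R} (hP : P ≠ ⊥) : Module.finrank F (R ⧸ P) = dg (F := F) P := by
  have := H.finite_quot hP
  have h1 := H.card_quot hP
  have h2 := Module.natCard_eq_pow_finrank (K := F) (V := R ⧸ P)
  rw [h1] at h2
  exact (Nat.pow_right_injective (q1 (F := F)) h2).symm

include H in
omit [IsDomain R] in
lemma card_fib [Finite E] {P : Ideal R} (hP : Prime P) (hd : dg (F := F) P ∣ Module.finrank F E) :
    Nat.card {φ : R →ₐ[F] E // RingHom.ker φ = P} = dg (F := F) P := by
  have hPp : P.IsPrime := Ideal.isPrime_of_prime hP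
  have hPm : P.IsMaximal := hPp.isMaximal hP.ne_zero
  letI : Field (R ⧸ P) := Ideal.Quotient.field P
  have h1 := H.finrank_quot hP.ne_zero
  rw [← h1] at hd
  have h2 := FiniteField.natCard_algHom_of_finrank_dvd hd
  rw [← h1, ← h2]
  let Φ : {φ : R →ₐ[F] E // RingHom.ker φ = P} → ((R ⧸ P) →ₐ[F] E) := fun φ =>
    Ideal.Quotient.liftₐ P φ.1 (fun a ha => by
      have := φ.2
      rw [← this] at ha; exact ha)
  refine Nat.card_congr (Equiv.ofBijective Φ ⟨?_, ?_⟩)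
  · rintro ⟨φ, hφ⟩ ⟨ψ, hψ⟩ h
    apply Subtype.ext
    ext z
    exact congrArg (fun χ : (R ⧸ P) →ₐ[F] E => χ (Ideal.Quotient.mk P z)) h
  · intro χ
    refine ⟨⟨χ.comp (Ideal.Quotient.mkₐ F P), ?_⟩, ?_⟩
    · ext z
      rw [RingHom.mem_ker]
      change χ (Ideal.Quotient.mk P z) = 0 ↔ _
      rw [map_eq_zero_iff χ χ.toRingHom.injective, Ideal.Quotient.eq_zero_iff_mem]
    · apply AlgHom.ext
      intro z
      obtain ⟨z, rfl⟩ := Ideal.Quotient.mk_surjective z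
      rfl

include H in
lemma ker_props [Finite E] (φ : R →ₐ[F] E) : Prime (RingHom.ker φ) ∧
    dg (F := F) (RingHom.ker φ) ∣ Module.finrank F E := by
  have hp : (RingHom.ker φ).IsPrime := RingHom.ker_isPrime φ
  have hb : RingHom.ker φ ≠ ⊥ := by
    intro h
    have : Function.Injective φ := (RingHom.injective_iff_ker_eq_bot _).mpr h
    have := Finite.of_injective φ this
    have := H.infinite
    exact not_finite R
  have hP : Prime (RingHom.ker φ) := Ideal.prime_of_isPrime hb hp
  refine ⟨hP, ?_⟩
  have hPm : (RingHom.ker φ).IsMaximal := hp.isMaximal hb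
  letI : Field (R ⧸ RingHom.ker φ) := Ideal.Quotient.field _
  rw [← H.finrank_quot hb]
  exact FiniteField.nonempty_algHom_iff_finrank_dvd.mp
    ⟨Ideal.Quotient.liftₐ (RingHom.ker φ) φ (fun a ha => ha)⟩

lemma vM_pts' [Finite E] : ∑ Q ∈ H.ids (Module.finrank F E), vM F Q = Nat.card (R →ₐ[F] E) := by
  classical
  set m := Module.finrank F E with hm
  have hm0 : 0 < m := Module.finrank_pos
  have hfin : Finite (R →ₐ[F] E) := by
    obtain ⟨e⟩ := H.hom_equiv (E := E)
    exact Finite.of_equiv _ e.symm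
  have := Fintype.ofFinite (R →ₐ[F] E)
  rw [Nat.card_eq_fintype_card, ← Finset.card_univ,
    Finset.card_eq_sum_card_fiberwise (t := H.ids m)
      (f := fun φ : R →ₐ[F] E => (RingHom.ker φ) ^ (m / dg (F := F) (RingHom.ker φ)))]
  · refine Finset.sum_congr rfl fun Q hQ => ?_
    rw [mem_ids] at hQ
    by_cases hpp : IsPrimePow Q
    · obtain ⟨P, k, hP, hk, rfl⟩ := hpp
      rw [vM_pow hP hk]
      have hd : k * dg (F := F) P = m := by rw [← H.dg_pow hP.ne_zero, hQ.2]
      have hd0 : 0 < dg (F := F) P := by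
        rcases Nat.eq_zero_or_pos (dg (F := F) P) with h | h
        · rw [h] at hd; omega
        · exact h
      rw [← H.card_fib (E := E) hP (Dvd.intro_left k hd), Nat.card_eq_fintype_card, Fintype.card_subtype]
      congr 1
      ext φ
      simp only [Finset.mem_filter, Finset.mem_univ, true_and]
      constructor
      · intro h
        rw [h, ← hd, Nat.mul_div_cancel _ hd0]
      · intro h
        exact (prime_pow_unique hP (H.ker_props φ).1 hk h.symm).symm
    · rw [vM_zero hpp]
      symm
      rw [Finset.card_eq_zero, Finset.filter_eq_empty_iff]
      intro φ _ h
      obtain ⟨h1, h2⟩ := H.ker_props φ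
      apply hpp
      refine ⟨_, _, h1, ?_, h⟩
      exact Nat.div_pos (Nat.le_of_dvd hm0 h2) (Nat.pos_of_dvd_of_pos h2 hm0)
  · intro φ _
    obtain ⟨h1, h2⟩ := H.ker_props φ
    rw [Finset.mem_coe, mem_ids]
    refine ⟨pow_ne_zero _ h1.ne_zero, ?_⟩
    rw [H.dg_pow h1.ne_zero, Nat.div_mul_cancel h2]

end pts

variable [Finite F] [IsDedekindDomain R]

lemma vM_pts (E : Type*) [Field E] [Algebra F E] [Finite E] :
    ∑ Q ∈ H.ids (Module.finrank F E), vM F Q = (pts f E).ncard := by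
  letI : Algebra F R := ((algebraMap F[X] R).comp C).toAlgebra
  haveI : IsScalarTower F F[X] R := IsScalarTower.of_algebraMap_eq (fun c => rfl)
  rw [H.vM_pts', H.card_hom]

lemma exists_ext (L : Type*) [Field L] [Finite L] (m : ℕ) (hm : 0 < m) :
    ∃ (E : Type) (_ : Field E) (_ : Algebra L E) (_ : Finite E), Module.finrank L E = m := by
  obtain ⟨p, hp⟩ := CharP.exists L
  haveI : Fact p.Prime := ⟨CharP.char_is_prime L p⟩
  haveI : NeZero m := ⟨hm.ne'⟩
  exact ⟨FiniteField.Extension L p m, inferInstance, inferInstance, inferInstance, FiniteField.finrank_extension L p m⟩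

lemma vM_transfer {L : Type*} [Field L] [Finite L] [Algebra F L] {f' : L[X]} (hf' : f' = f.map (algebraMap F L))
    {S : Type*} [CommRing S] [IsDomain S] [Algebra L[X] S] {y : S} (H' : HR f' y) [IsDedekindDomain S]
    (m : ℕ) (hm : 0 < m) :
    ∑ Q ∈ H'.ids m, vM L Q = ∑ Q ∈ H.ids (Module.finrank F L * m), vM F Q := by
  obtain ⟨E, i1, i2, i3, h1⟩ := exists_ext L m hm
  letI : Algebra F E := ((algebraMap L E).comp (algebraMap F L)).toAlgebra
  haveI : IsScalarTower F L E := IsScalarTower.of_algebraMap_eq (fun c => rfl)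
  have h2 : Module.finrank F E = Module.finrank F L * m := by
    rw [← h1, Module.finrank_mul_finrank]
  rw [← h2]
  conv_lhs => rw [← h1]
  rw [H.vM_pts E, H'.vM_pts E]
  congr 1
  ext t
  change t.2 ^ 2 = aeval t.1 f' ↔ t.2 ^ 2 = aeval t.1 f
  rw [hf', aeval_map_algebraMap]

lemma aX_one {Fo : Type*} [Field Fo] (m : ℕ) : H.aX (fun _ => (1 : Fo)) m = ((∑ Q ∈ H.ids m, vM F Q : ℕ) : Fo) := by
  unfold aX; simp

end HR
end HypE
end

section
open Polynomial nonZeroDivisors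

set_option linter.all false

namespace HypE

section pm
variable {F L : Type*} [Field F] [Field L] [Algebra F L]

/-- coefficientwise application of a functional -/
noncomputable def pm (l : L →ₗ[F] F) (a : L[X]) : F[X] :=
  ∑ i ∈ Finset.range (a.natDegree + 1), monomial i (l (a.coeff i))

lemma coeff_pm (l : L →ₗ[F] F) (a : L[X]) (i : ℕ) : (pm l a).coeff i = l (a.coeff i) := by
  unfold pm
  rw [finset_sum_coeff]
  simp only [coeff_monomial]
  rw [Finset.sum_ite_eq']
  split_ifs with h
  · rfl
  · rw [coeff_eq_zero_of_natDegree_lt (by simpa using h), map_zero]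

lemma pm_add (l : L →ₗ[F] F) (a b : L[X]) : pm l (a + b) = pm l a + pm l b := by
  ext i; simp [coeff_pm]

lemma pm_zero (l : L →ₗ[F] F) : pm l (0 : L[X]) = 0 := by
  ext i; simp [coeff_pm]

lemma pm_mul (l : L →ₗ[F] F) (a : F[X]) (b : L[X]) : pm l (a.map (algebraMap F L) * b) = a * pm l b := by
  ext i
  rw [coeff_pm, coeff_mul, coeff_mul, map_sum]
  refine Finset.sum_congr rfl fun s _ => ?_
  rw [coeff_pm, coeff_map, ← Algebra.smul_def, map_smul, smul_eq_mul]

lemma natDegree_pm (l : L →ₗ[F] F) (a : L[X]) : (pm l a).natDegree ≤ a.natDegree := by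
  rw [natDegree_le_iff_coeff_eq_zero]
  intro i hi
  rw [coeff_pm, coeff_eq_zero_of_natDegree_lt hi, map_zero]

lemma pm_C (l : L →ₗ[F] F) (c : L) : pm l (C c) = C (l c) := by
  ext i
  rw [coeff_pm, coeff_C, coeff_C]
  split_ifs <;> simp

lemma pm_sum {ι : Type*} [Fintype ι] (w : Module.Basis ι F L) (a : L[X]) :
    a = ∑ i, (pm (w.coord i) a).map (algebraMap F L) * C (w i) := by
  ext j
  rw [finset_sum_coeff]
  simp only [coeff_mul_C, coeff_map, coeff_pm]
  conv_lhs => rw [← w.sum_repr (a.coeff j)]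
  refine Finset.sum_congr rfl fun i _ => ?_
  rw [Algebra.smul_def]; rfl

end pm

/-- constant field extension -/
structure Tower {F L : Type*} [Field F] [Field L] [Algebra F L] {f : F[X]} {f' : L[X]}
    {R S : Type*} [CommRing R] [CommRing S] [Algebra F[X] R] [Algebra L[X] S] [Algebra R S] {x : R} {y : S}
    (H : HR f x) (H' : HR f' y) : Prop where
  hf : f' = f.map (algebraMap F L)
  hx : algebraMap R S x = y
  ham : ∀ a : F[X], algebraMap R S (algebraMap F[X] R a) = algebraMap L[X] S (a.map (algebraMap F L))

namespace Tower
variable {F L : Type*} [Field F] [Field L] [Algebra F L] {f : F[X]} {f' : L[X]}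
    {R S : Type*} [CommRing R] [CommRing S] [Algebra F[X] R] [Algebra L[X] S] [Algebra R S] {x : R} {y : S}
    {H : HR f x} {H' : HR f' y} (T : Tower H H')

local notation "am" => algebraMap F[X] R
local notation "amS" => algebraMap L[X] S

include T in
lemma co_map (z : R) : H'.ca (algebraMap R S z) = (H.ca z).map (algebraMap F L) ∧
    H'.cb (algebraMap R S z) = (H.cb z).map (algebraMap F L) := by
  apply H'.co_unique
  conv_lhs => rw [H.eq_co z]
  rw [map_add, map_mul, T.ham, T.ham, T.hx]

/-- coefficientwise application of a functional -/
noncomputable def sm (H : HR f x) (H' : HR f' y) (l : L →ₗ[F] F) (s : S) : R :=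
  am (pm l (H'.ca s)) + am (pm l (H'.cb s)) * x

lemma sm_add (l : L →ₗ[F] F) (s t : S) : sm H H' l (s + t) = sm H H' l s + sm H H' l t := by
  unfold sm; rw [H'.ca_add, H'.cb_add, pm_add, pm_add, map_add, map_add]; ring

lemma sm_zero (l : L →ₗ[F] F) : sm H H' l 0 = 0 := by
  unfold sm; rw [H'.co_zero.1, H'.co_zero.2, pm_zero]; simp

include T in
lemma sm_mul (l : L →ₗ[F] F) (r : R) (s : S) : sm H H' l (algebraMap R S r * s) = r * sm H H' l s := by
  unfold sm
  have e : f' * (H.cb r).map (algebraMap F L) = (f * H.cb r).map (algebraMap F L) := by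
    rw [Polynomial.map_mul, ← T.hf]
  rw [(H'.co_mul _ _).1, (H'.co_mul _ _).2, (T.co_map r).1, (T.co_map r).2, e, pm_add, pm_add,
    pm_mul, pm_mul, pm_mul, pm_mul]
  conv_rhs => rw [H.eq_co r]
  simp only [map_add, map_mul]
  rw [← H.sq]
  ring

lemma co_sm (l : L →ₗ[F] F) (s : S) : H.ca (sm H H' l s) = pm l (H'.ca s) ∧ H.cb (sm H H' l s) = pm l (H'.cb s) :=
  H.co_unique rfl

include T in
lemma D_sm (l : L →ₗ[F] F) (s : S) (h : sm H H' l s ≠ 0) : H.D (sm H H' l s) ≤ H'.D s := by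
  have hd : f'.natDegree = f.natDegree := by rw [T.hf, natDegree_map]
  have h1 : H.Lt (sm H H' l s) (H'.D s + 1) := by
    have h2 : H'.Lt s (H'.D s + 1) := (H'.Lt_iff _ _).mpr (Or.inr (Nat.lt_succ_self _))
    unfold HR.Lt at h2 ⊢
    rw [(co_sm l s).1, (co_sm l s).2]
    have h3 := natDegree_pm l (H'.ca s)
    have h4 := natDegree_pm l (H'.cb s)
    constructor
    · intro h5
      have := h2.1 (by rintro h6; rw [h6, pm_zero] at h5; exact h5 rfl)
      omega
    · intro h5
      have := h2.2 (by rintro h6; rw [h6, pm_zero] at h5; exact h5 rfl)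
      omega
  rcases (H.Lt_iff _ _).mp h1 with h2 | h2
  · exact absurd h2 h
  · omega

include T in
lemma sm_sum {ι : Type*} [Fintype ι] (w : Module.Basis ι F L) (s : S) :
    s = ∑ i, algebraMap R S (sm H H' (w.coord i) s) * amS (C (w i)) := by
  unfold sm
  simp only [map_add, map_mul, T.ham, T.hx, add_mul, Finset.sum_add_distrib]
  conv_lhs => rw [H'.eq_co s]
  conv_lhs => enter [1]; rw [pm_sum w (H'.ca s)]
  conv_lhs => enter [2]; rw [pm_sum w (H'.cb s)]
  simp only [map_sum, map_mul, Finset.sum_mul]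
  congr 1
  refine Finset.sum_congr rfl fun i _ => ?_
  ring

lemma sm_C (l : L →ₗ[F] F) (c : L) : sm H H' l (amS (C c)) = am (C (l c)) := by
  unfold sm
  rw [(H'.co_am _).1, (H'.co_am _).2, pm_C, pm_zero]; simp

include T in
/-- basis -/
lemma exists_basis {ι : Type*} [Fintype ι] [DecidableEq ι] (w : Module.Basis ι F L) :
    Nonempty (Module.Basis ι R S) := by
  have hadd : ∀ (i : ι) (t : Finset ι) (g : ι → S), sm H H' (w.coord i) (∑ j ∈ t, g j) = ∑ j ∈ t, sm H H' (w.coord i) (g j) := by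
    intro i t g
    induction t using Finset.induction_on with
    | empty => simp [sm_zero]
    | insert a t ha ih => rw [Finset.sum_insert ha, Finset.sum_insert ha, sm_add, ih]
  let e : S ≃ₗ[R] (ι → R) := {
    toFun := fun s i => sm H H' (w.coord i) s
    map_add' := fun s t => by ext i; exact sm_add _ s t
    map_smul' := fun r s => by
      ext i
      simp only [Algebra.smul_def, RingHom.id_apply, Pi.smul_apply, smul_eq_mul]
      exact T.sm_mul _ r s
    invFun := fun r => ∑ i, algebraMap R S (r i) * amS (C (w i))
    left_inv := fun s => (T.sm_sum w s).symm
    right_inv := fun r => by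
      ext i
      change sm H H' (w.coord i) (∑ i, algebraMap R S (r i) * amS (C (w i))) = r i
      rw [hadd, Finset.sum_eq_single i]
      · rw [T.sm_mul, sm_C]; simp
      · intro j _ hj
        rw [T.sm_mul, sm_C]; simp [hj]
      · intro h; exact absurd (Finset.mem_univ _) h }
  exact ⟨Module.Basis.ofEquivFun e⟩

include T in
lemma mfin [FiniteDimensional F L] : Module.Finite R S := by
  obtain ⟨b⟩ := T.exists_basis (Module.finBasis F L)
  exact Module.Finite.of_basis b

include T in
lemma finrank [Nontrivial R] [FiniteDimensional F L] : Module.finrank R S = Module.finrank F L := by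
  obtain ⟨b⟩ := T.exists_basis (Module.finBasis F L)
  rw [Module.finrank_eq_card_basis b, Fintype.card_fin]

include T in
lemma inj : Function.Injective (algebraMap R S) := by
  rw [injective_iff_map_eq_zero]
  intro z hz
  have := T.co_map z
  rw [hz, H'.co_zero.1, H'.co_zero.2] at this
  apply H.eq_zero_of
  · exact (Polynomial.map_eq_zero_iff (algebraMap F L).injective).mp this.1.symm
  · exact (Polynomial.map_eq_zero_iff (algebraMap F L).injective).mp this.2.symm

include T in
lemma tf [IsDomain R] [IsDomain S] : Module.IsTorsionFree R S := by
  have : FaithfulSMul R S := (faithfulSMul_iff_algebraMap_injective R S).mpr T.inj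
  infer_instance

variable [Finite F] [Finite L] [IsDomain R] [IsDomain S]

include T in
lemma dg_map_le {I : Ideal R} (hI : I ≠ ⊥) : HR.dg (F := L) (I.map (algebraMap R S)) ≤ HR.dg (F := F) I := by
  classical
  have : Finite (R ⧸ I) := H.finite_quot hI
  have hI' : I.map (algebraMap R S) ≠ ⊥ := by
    intro h; exact hI ((Ideal.map_eq_bot_iff_of_injective T.inj).mp h)
  set n := Module.finrank F L
  let w := Module.finBasis F L
  let Φ : (Fin n → R ⧸ I) → S ⧸ I.map (algebraMap R S) := fun u =>
    Ideal.Quotient.mk _ (∑ i, algebraMap R S (Quotient.out (u i)) * amS (C (w i)))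
  have hs : Function.Surjective Φ := by
    intro s
    obtain ⟨s, rfl⟩ := Ideal.Quotient.mk_surjective s
    obtain ⟨sf, e⟩ : ∃ sf : Fin n → R, s = ∑ i, algebraMap R S (sf i) * amS (C (w i)) :=
      ⟨_, T.sm_sum w s⟩
    refine ⟨fun i => Ideal.Quotient.mk I (sf i), ?_⟩
    refine Ideal.Quotient.eq.mpr ?_
    rw [e, ← Finset.sum_sub_distrib]
    refine Ideal.sum_mem _ fun i _ => ?_
    rw [← sub_mul, ← map_sub]
    apply Ideal.mul_mem_right
    apply Ideal.mem_map_of_mem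
    rw [← Ideal.Quotient.eq]
    exact Quotient.out_eq _
  have h1 := Nat.card_le_card_of_surjective Φ hs
  rw [Nat.card_fun, H'.card_quot hI', H.card_quot hI, Nat.card_fin, Module.natCard_eq_pow_finrank (K := F) (V := L), ← pow_mul,
    ← pow_mul] at h1
  have h2 := (Nat.pow_le_pow_iff_right (HR.q1 (F := F))).mp h1
  have h3 : 0 < n := Module.finrank_pos
  have : n * HR.dg (F := L) (I.map (algebraMap R S)) ≤ n * HR.dg (F := F) I := by
    rw [mul_comm n (HR.dg (F := F) I)]; exact h2
  exact Nat.le_of_mul_le_mul_left this h3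

include T in
lemma principal {I : Ideal R} (hI : I ≠ ⊥) (α : S) (h : I.map (algebraMap R S) = Ideal.span {α}) :
    ∃ β, β ≠ 0 ∧ I = Ideal.span {β} := by
  have hI' : I.map (algebraMap R S) ≠ ⊥ := by
    intro h; exact hI ((Ideal.map_eq_bot_iff_of_injective T.inj).mp h)
  have hα : α ≠ 0 := by
    rintro rfl; apply hI'; rw [h]; simp
  let w := Module.finBasis F L
  have hex : ∃ i, sm H H' (w.coord i) α ≠ 0 := by
    by_contra hc
    push Not at hc
    apply hα
    rw [T.sm_sum w α]
    simp [hc]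
  obtain ⟨i, hi⟩ := hex
  set β := sm H H' (w.coord i) α with hβ
  have hmem : ∀ s ∈ I.map (algebraMap R S), sm H H' (w.coord i) s ∈ I := by
    intro s hs
    refine Submodule.span_induction ?_ ?_ ?_ ?_ hs
      (p := fun s _ => ∀ t, sm H H' (w.coord i) (t * s) ∈ I) 1 |> fun h => by simpa using h
    · rintro _ ⟨a, ha, rfl⟩ t
      rw [mul_comm, T.sm_mul]
      exact Ideal.mul_mem_right _ _ ha
    · intro t; rw [mul_zero, sm_zero]; exact I.zero_mem
    · intro a b _ _ ha hb t
      rw [mul_add, sm_add]; exact I.add_mem (ha t) (hb t)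
    · intro a b _ hb t
      rw [smul_eq_mul, ← mul_assoc]; exact hb _
  have hβI : β ∈ I := hmem α (by rw [h]; exact Ideal.mem_span_singleton_self α)
  refine ⟨β, hi, ?_⟩
  symm
  apply H.eq_of_dg
  · simpa using hi
  · rwa [Ideal.span_singleton_le_iff_mem]
  · apply le_antisymm
    · rw [H.dg_span hi]; exact H.dg_le_D hβI hi
    · rw [H.dg_span hi]
      calc H.D β ≤ H'.D α := T.D_sm _ _ hi
        _ = HR.dg (F := L) (Ideal.span {α}) := (H'.dg_span hα).symm
        _ ≤ _ := by rw [← h]; exact T.dg_map_le hI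

end Tower
end HypE
end

section
open Polynomial nonZeroDivisors

set_option linter.all false

namespace HypE

section norm
open HR
variable {R S : Type*} [CommRing R] [CommRing S] [Algebra R S] [IsDomain R] [IsDomain S] [IsDedekindDomain R]
  [IsDedekindDomain S] [Module.Finite R S] [Module.IsTorsionFree R S]

lemma cl_exists (c : ClassGroup S) : ∃ J : Ideal S, J ≠ ⊥ ∧ cl J = c := by
  obtain ⟨J, rfl⟩ := ClassGroup.mk0_surjective c
  exact ⟨J, nonZeroDivisors.coe_ne_zero J, cl_of (nonZeroDivisors.coe_ne_zero J)⟩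

lemma cl_eq {I J : Ideal S} (hI : I ≠ ⊥) (hJ : J ≠ ⊥) : cl I = cl J ↔
    ∃ (x y : S) (_ : x ≠ 0) (_ : y ≠ 0), Ideal.span {x} * I = Ideal.span {y} * J := by
  rw [cl_of hI, cl_of hJ, ClassGroup.mk0_eq_mk0_iff]

lemma relNorm_ne {J : Ideal S} (hJ : J ≠ ⊥) : Ideal.relNorm R J ≠ ⊥ := by
  rwa [Ne, Ideal.relNorm_eq_bot_iff]

lemma span_ne {x : S} (hx : x ≠ 0) : Ideal.span {x} ≠ ⊥ := by simpa using hx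

lemma cl_span {x : S} (hx : x ≠ 0) : cl (Ideal.span {x}) = 1 := by
  rw [cl_of (span_ne hx), ClassGroup.mk0_eq_one_iff]
  exact ⟨x, rfl⟩

lemma cl_relNorm {I J : Ideal S} (hI : I ≠ ⊥) (hJ : J ≠ ⊥) (h : cl I = cl J) :
    cl (Ideal.relNorm R I) = cl (Ideal.relNorm R J) := by
  obtain ⟨x, y, hx, hy, h⟩ := (cl_eq hI hJ).mp h
  have h2 := congrArg (Ideal.relNorm R) h
  rw [map_mul, map_mul] at h2
  have key : ∀ z : S, z ≠ 0 → cl (Ideal.relNorm R (Ideal.span {z})) = 1 := by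
    intro z hz
    have h3 := relNorm_ne (R := R) (span_ne hz)
    rw [Ideal.relNorm_singleton] at h3 ⊢
    apply cl_span
    rintro h4; rw [h4] at h3; simp at h3
  have h3 := congrArg cl h2
  rwa [cl_mul (relNorm_ne (span_ne hx)) (relNorm_ne hI), cl_mul (relNorm_ne (span_ne hy)) (relNorm_ne hJ),
    key x hx, key y hy, one_mul, one_mul] at h3

variable (R S) in
/-- the norm on class groups -/
noncomputable def Ncl : ClassGroup S →* ClassGroup R :=
  MonoidHom.mk' (fun c => cl (Ideal.relNorm R (cl_exists c).choose)) (by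
    intro a b
    obtain ⟨ha, ha'⟩ := (cl_exists a).choose_spec
    obtain ⟨hb, hb'⟩ := (cl_exists b).choose_spec
    obtain ⟨hab, hab'⟩ := (cl_exists (a * b)).choose_spec
    rw [← cl_mul (relNorm_ne ha) (relNorm_ne hb), ← map_mul]
    apply cl_relNorm hab (mul_ne_zero ha hb)
    rw [cl_mul ha hb, ha', hb', hab'])

lemma Ncl_cl {J : Ideal S} (hJ : J ≠ ⊥) : Ncl R S (cl J) = cl (Ideal.relNorm R J) := by
  obtain ⟨h, h'⟩ := (cl_exists (cl J)).choose_spec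
  exact cl_relNorm h hJ h'

lemma Ncl_ext (c : ClassGroup R) : Ncl R S (ClassGroup.extendedHom R S c) = c ^ Module.finrank R S := by
  obtain ⟨I, rfl⟩ := ClassGroup.mk0_surjective c
  rw [ClassGroup.extendedHom_mk0]
  have h1 := nonZeroDivisors.coe_ne_zero I
  have h2 := nonZeroDivisors.coe_ne_zero (ClassGroup.extendedIdeal R S I)
  have e1 : ClassGroup.mk0 I = cl (I : Ideal R) := (cl_of h1).symm
  have e2 : ClassGroup.mk0 (ClassGroup.extendedIdeal R S I) = cl (ClassGroup.extendedIdeal R S I : Ideal S) := (cl_of h2).symm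
  rw [e2, Ncl_cl h2, e1, ← cl_pow h1, Ideal.relNorm_algebraMap]

end norm

namespace Tower
variable {F L : Type*} [Field F] [Field L] [Algebra F L] {f : F[X]} {f' : L[X]}
    {R S : Type*} [CommRing R] [CommRing S] [Algebra F[X] R] [Algebra L[X] S] [Algebra R S] {x : R} {y : S}
    {H : HR f x} {H' : HR f' y} (T : Tower H H')

local notation "am" => algebraMap F[X] R
local notation "amS" => algebraMap L[X] S

variable [Finite F] [Finite L] [IsDomain R] [IsDomain S] [IsDedekindDomain R]
  [IsDedekindDomain S] [Module.Finite R S] [Module.IsTorsionFree R S]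

include T in
lemma ext_inj : Function.Injective (ClassGroup.extendedHom R S) := by
  rw [injective_iff_map_eq_one]
  intro c hc
  obtain ⟨I, rfl⟩ := ClassGroup.mk0_surjective c
  rw [ClassGroup.extendedHom_mk0, ClassGroup.mk0_eq_one_iff] at hc
  obtain ⟨α, hα⟩ := hc
  obtain ⟨β, hβ, h⟩ := T.principal (nonZeroDivisors.coe_ne_zero I) α hα
  rw [ClassGroup.mk0_eq_one_iff]
  exact ⟨β, h⟩

open Classical in
include T in
lemma exists_relNorm {P : Ideal R} (hP : Prime P) (hd : Module.finrank F L ∣ HR.dg (F := F) P) :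
    ∃ Q : Ideal S, Q ≠ ⊥ ∧ Ideal.relNorm R Q = P := by
  letI : Algebra F R := ((algebraMap F[X] R).comp C).toAlgebra
  haveI : IsScalarTower F F[X] R := IsScalarTower.of_algebraMap_eq (fun c => rfl)
  letI : Algebra L S := ((algebraMap L[X] S).comp C).toAlgebra
  haveI : IsScalarTower L L[X] S := IsScalarTower.of_algebraMap_eq (fun c => rfl)
  have hPp : P.IsPrime := Ideal.isPrime_of_prime hP
  have hPm : P.IsMaximal := hPp.isMaximal hP.ne_zero
  letI : Field (R ⧸ P) := Ideal.Quotient.field P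
  have : Finite (R ⧸ P) := H.finite_quot hP.ne_zero
  rw [← H.finrank_quot hP.ne_zero] at hd
  have hcard : Nat.card (L →ₐ[F] (R ⧸ P)) = Module.finrank F L := FiniteField.natCard_algHom_of_finrank_dvd hd
  have hn : 0 < Module.finrank F L := Module.finrank_pos
  have hfin : Finite (L →ₐ[F] (R ⧸ P)) := Nat.finite_of_card_ne_zero (by omega)
  have := Fintype.ofFinite (L →ₐ[F] (R ⧸ P))
  have hm : ∀ a : F[X], Ideal.Quotient.mk P (am a) = aeval (Ideal.Quotient.mk P (am X)) a := by
    intro a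
    have : ((Ideal.Quotient.mkₐ F P).comp (IsScalarTower.toAlgHom F F[X] R)) = aeval (Ideal.Quotient.mk P (am X)) := by
      ext; simp
    have h2 := congrArg (fun ψ : F[X] →ₐ[F] (R ⧸ P) => ψ a) this
    simpa using h2
  have hex : ∀ σ : L →ₐ[F] (R ⧸ P), ∃ ψ : S →+* (R ⧸ P), (∀ r, ψ (algebraMap R S r) = Ideal.Quotient.mk P r) ∧
      ∀ c, ψ (amS (C c)) = σ c := by
    intro σ
    letI : Algebra L (R ⧸ P) := σ.toRingHom.toAlgebra
    haveI : IsScalarTower F L (R ⧸ P) := IsScalarTower.of_algebraMap_eq (fun c => (σ.commutes c).symm)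
    have ht : (Ideal.Quotient.mk P (am X), Ideal.Quotient.mk P x) ∈ HR.pts f' (R ⧸ P) := by
      change (Ideal.Quotient.mk P x) ^ 2 = aeval (Ideal.Quotient.mk P (am X)) f'
      rw [T.hf, aeval_map_algebraMap, ← map_pow, H.sq, hm]
    refine ⟨(H'.evalPt _ ht).toRingHom, ?_, ?_⟩
    · intro r
      change aeval (Ideal.Quotient.mk P (am X)) (H'.ca (algebraMap R S r)) +
        aeval (Ideal.Quotient.mk P (am X)) (H'.cb (algebraMap R S r)) * Ideal.Quotient.mk P x = _
      rw [(T.co_map r).1, (T.co_map r).2, aeval_map_algebraMap, aeval_map_algebraMap, ← hm, ← hm, ← map_mul, ← map_add,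
        ← H.eq_co]
    · intro c
      exact (H'.evalPt _ ht).commutes c
  choose ψ hψ1 hψ2 using hex
  let Q : (L →ₐ[F] (R ⧸ P)) → Ideal S := fun σ => RingHom.ker (ψ σ)
  have hinj : Function.Injective Q := by
    intro σ τ h
    ext c
    obtain ⟨r, hr⟩ := Ideal.Quotient.mk_surjective (σ c)
    have h1 : amS (C c) - algebraMap R S r ∈ Q σ := by
      change ψ σ _ = 0
      rw [map_sub, hψ1, hψ2, hr, sub_self]
    rw [h] at h1
    have h1 : ψ τ (amS (C c) - algebraMap R S r) = 0 := h1
    rw [map_sub, hψ1, hψ2, hr, sub_eq_zero] at h1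
    exact h1.symm
  have hcomap : ∀ σ, (Q σ).comap (algebraMap R S) = P := by
    intro σ
    ext r
    rw [Ideal.mem_comap]
    change ψ σ (algebraMap R S r) = 0 ↔ _
    rw [hψ1, Ideal.Quotient.eq_zero_iff_mem]
  have hPS : P.map (algebraMap R S) ≠ ⊥ := by
    intro h; exact hP.ne_zero ((Ideal.map_eq_bot_iff_of_injective T.inj).mp h)
  have hle : ∀ σ, P.map (algebraMap R S) ≤ Q σ := by
    intro σ; rw [Ideal.map_le_iff_le_comap, hcomap]
  have hQ : ∀ σ, Prime (Q σ) := by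
    intro σ
    apply Ideal.prime_of_isPrime
    · intro h
      apply hPS
      have := hle σ
      rw [h] at this
      exact le_bot_iff.mp this
    · exact RingHom.ker_isPrime _
  have hs : ∀ σ, ∃ s, Ideal.relNorm R (Q σ) = P ^ s ∧ 1 ≤ s := by
    intro σ
    have hlo : (Q σ).LiesOver P := ⟨(hcomap σ).symm⟩
    obtain ⟨s, hs⟩ := Ideal.exists_relNorm_eq_pow_of_isPrime (Q σ) P
    refine ⟨s, hs, ?_⟩
    by_contra h
    have h0 : s = 0 := by omega
    have h1 := Ideal.relNorm_le_comap R (Q σ)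
    rw [hs, h0, pow_zero, hcomap, Ideal.one_eq_top] at h1
    exact hPp.ne_top (top_le_iff.mp h1)
  choose s hs1 hs2 using hs
  have hdvd : ∏ σ, Q σ ∣ P.map (algebraMap R S) := by
    have := Finset.prod_primes_dvd (s := Finset.univ.image Q) (P.map (algebraMap R S)) (by
        intro a ha
        obtain ⟨σ, _, rfl⟩ := Finset.mem_image.mp ha
        exact hQ σ) (by
        intro a ha
        obtain ⟨σ, _, rfl⟩ := Finset.mem_image.mp ha
        exact Ideal.dvd_iff_le.mpr (hle σ))
    rwa [Finset.prod_image (fun a _ b _ h => hinj h)] at this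
  have h1 := map_dvd (Ideal.relNorm R) hdvd
  rw [Ideal.relNorm_algebraMap, map_prod, Finset.prod_congr rfl (fun σ _ => hs1 σ), Finset.prod_pow_eq_pow_sum,
    pow_dvd_pow_iff hP.ne_zero hP.not_unit, T.finrank] at h1
  have h2 : Fintype.card (L →ₐ[F] (R ⧸ P)) = Module.finrank F L := by rw [← hcard, Nat.card_eq_fintype_card]
  obtain ⟨σ⟩ : Nonempty (L →ₐ[F] (R ⧸ P)) := Fintype.card_pos_iff.mp (by omega)
  refine ⟨Q σ, (hQ σ).ne_zero, ?_⟩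
  have h3 : s σ = 1 := by
    by_contra hne
    have h4 : ∑ τ : L →ₐ[F] (R ⧸ P), 1 < ∑ τ, s τ :=
      Finset.sum_lt_sum (fun τ _ => hs2 τ) ⟨σ, Finset.mem_univ _, lt_of_le_of_ne (hs2 σ) (Ne.symm hne)⟩
    rw [Finset.sum_const, Finset.card_univ, h2] at h4
    simp at h4
    omega
  rw [hs1, h3, pow_one]

end Tower
end HypE
end

section
open Polynomial nonZeroDivisors

set_option linter.all false

namespace HypE
namespace Tower
variable {F L : Type*} [Field F] [Field L] [Algebra F L] {f : F[X]} {f' : L[X]}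
    {R S : Type*} [CommRing R] [CommRing S] [Algebra F[X] R] [Algebra L[X] S] [Algebra R S] {x : R} {y : S}
    {H : HR f x} {H' : HR f' y} (T : Tower H H')

variable [Finite F] [Finite L] [IsDomain R] [IsDomain S] [IsDedekindDomain R]
  [IsDedekindDomain S] [Module.Finite R S] [Module.IsTorsionFree R S]

include T in
lemma N_surj (hp : (Module.finrank F L).Prime) : Function.Surjective (Ncl R S) := by
  classical
  set p := Module.finrank F L with hpdef
  have hfr : Module.finrank R S = p := T.finrank
  have := H.finite_class
  have := H'.finite_class
  have := Fintype.ofFinite (ClassGroup S)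
  rw [← MonoidHom.range_eq_top]
  by_contra hne
  obtain ⟨c, hc⟩ : ∃ c, c ∉ (Ncl R S).range := by
    by_contra h; push Not at h; exact hne ((Subgroup.eq_top_iff' _).mpr h)
  have hc1 : (QuotientGroup.mk c : ClassGroup R ⧸ (Ncl R S).range) ≠ 1 := by
    rwa [Ne, QuotientGroup.eq_one_iff]
  obtain ⟨φ, hφ⟩ := CommGroup.exists_apply_ne_one_of_hasEnoughRootsOfUnity (ClassGroup R ⧸ (Ncl R S).range) ℂ hc1
  let χ : ClassGroup R →* ℂ := (Units.coeHom ℂ).comp (φ.comp (QuotientGroup.mk' _))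
  have hχ : χ ≠ 1 := by
    intro h
    have h1 : χ c = 1 := by rw [h]; rfl
    apply hφ
    exact Units.ext h1
  have hχN : ∀ d, χ (Ncl R S d) = 1 := by
    intro d
    have h1 : (QuotientGroup.mk (Ncl R S d) : ClassGroup R ⧸ (Ncl R S).range) = 1 := by
      rw [QuotientGroup.eq_one_iff]; exact ⟨d, rfl⟩
    change ((φ (QuotientGroup.mk (Ncl R S d)) : ℂˣ) : ℂ) = 1
    rw [h1, map_one]; rfl
  set X : Ideal R → ℂ := fun J => χ (HR.cl J) with hX
  have hLD := H.LD_L X (fun I J hI hJ => by simp only [hX]; rw [HR.cl_mul hI hJ, map_mul])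
  obtain ⟨P, hP⟩ : ∃ P : ℂ[X], (P : PowerSeries ℂ) = PowerSeries.mk (H.cX X) := by
    refine ⟨PowerSeries.trunc (2 * (f.natDegree / 2)) (PowerSeries.mk (H.cX X)), ?_⟩
    ext d
    rw [Polynomial.coeff_coe, PowerSeries.coeff_trunc]
    split_ifs with h
    · rfl
    · rw [PowerSeries.coeff_mk, H.cX_char_large χ hχ d (by omega)]
  have hP0 : P.coeff 0 = 1 := by
    rw [← Polynomial.coeff_coe, hP, PowerSeries.coeff_mk, H.cX_zero]
    simp only [hX]; rw [HR.cl_top, map_one]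
  rw [← hP] at hLD
  obtain ⟨s, hs, hpow⟩ := pow_transfer P hP0 _ hLD
  have hX1 : ∀ m, ∀ Q ∈ H.ids (p * m), (HR.vM F Q : ℂ) * X Q = (HR.vM F Q : ℂ) := by
    intro m Q hQ
    rw [HR.mem_ids] at hQ
    by_cases hpp : IsPrimePow Q
    · obtain ⟨P, k, hP, hk, rfl⟩ := hpp
      have hXQ : X (P ^ k) = 1 := by
        simp only [hX]
        rw [HR.cl_pow hP.ne_zero]
        have hd : k * HR.dg (F := F) P = p * m := by rw [← H.dg_pow hP.ne_zero, hQ.2]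
        have hdv : p ∣ k * HR.dg (F := F) P := Dvd.intro _ hd.symm
        rcases hp.dvd_mul.mp hdv with h | h
        · obtain ⟨j, rfl⟩ := h
          rw [mul_comm, pow_mul, ← hfr, ← Ncl_ext, hχN]
        · obtain ⟨Q, hQ0, hQ⟩ := T.exists_relNorm hP h
          conv_lhs => rw [← hQ]
          rw [← Ncl_cl hQ0, map_pow, hχN, one_pow]
      rw [hXQ, mul_one]
    · rw [HR.vM_zero hpp]; simp
  have hZ := hpow p hp.pos (PowerSeries.mk (H'.cX (fun _ => (1 : ℂ)))) (H'.aX (fun _ => (1 : ℂ)))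
    (H'.LD_L _ (fun _ _ _ _ => (mul_one _).symm))
    (by rw [PowerSeries.coeff_mk, H'.cX_zero _ rfl])
    (by
      intro m hm
      rw [H'.aX_one, H.vM_transfer T.hf H' m hm]
      unfold HR.aX
      rw [Finset.sum_congr rfl (hX1 m)]
      push_cast; rfl)
  set Z := (s.map fun β => 1 - C (β ^ p) * Polynomial.X).prod with hZdef
  have h1 := congrArg (PowerSeries.coeff (Z.natDegree + 1 + 2 * (f'.natDegree / 2))) hZ
  rw [PowerSeries.coeff_mk, Polynomial.coeff_coe, coeff_eq_zero_of_natDegree_lt (by omega),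
    H'.cX_one_large _ (by omega)] at h1
  have h2 : Nat.card L ≠ 0 := Nat.card_pos.ne'
  have h3 : Nat.card (ClassGroup S) ≠ 0 := Nat.card_pos.ne'
  rcases mul_eq_zero.mp h1 with h | h
  · exact h3 (by exact_mod_cast h)
  · exact h2 (by exact_mod_cast (pow_eq_zero_iff (by omega)).mp h)

end Tower

/-- `p`-torsion count -/
lemma card_tors {A : Type*} [CommGroup A] [Finite A] (p : ℕ) :
    Nat.card (powMonoidHom p : A →* A).ker = Nat.card (A ⧸ (powMonoidHom p : A →* A).range) := by
  have h1 := Subgroup.card_mul_index (powMonoidHom p : A →* A).ker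
  have h2 := Subgroup.card_mul_index (powMonoidHom p : A →* A).range
  rw [Subgroup.index_ker] at h1
  rw [← Subgroup.index_eq_card]
  have h3 : 0 < Nat.card (powMonoidHom p : A →* A).range := Nat.card_pos
  apply Nat.eq_of_mul_eq_mul_right h3
  rw [h1, ← h2, mul_comm]

/-- group theory step -/
lemma group_step {A B : Type*} [CommGroup A] [CommGroup B] [Finite A] [Finite B] (p : ℕ) (j : A →* B) (N : B →* A)
    (hj : Function.Injective j) (hN : Function.Surjective N) (h : ∀ a, N (j a) = a ^ p) :
    Nat.card (powMonoidHom p : A →* A).ker ∣ Nat.card (powMonoidHom p : B →* B).ker ∧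
    Nat.card A * Nat.card (powMonoidHom p : A →* A).ker ∣ Nat.card B := by
  have h0 : Nat.card ((powMonoidHom p : A →* A).ker.map j) = Nat.card (powMonoidHom p : A →* A).ker :=
    (Nat.card_congr ((powMonoidHom p : A →* A).ker.equivMapOfInjective j hj).toEquiv).symm
  constructor
  · rw [← h0]
    apply Subgroup.card_dvd_of_le
    rintro _ ⟨a, ha, rfl⟩
    have ha : a ^ p = 1 := ha
    change (j a) ^ p = 1
    rw [← map_pow, ha, map_one]
  · have h1 : Nat.card (powMonoidHom p : A →* A).ker ∣ Nat.card N.ker := by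
      rw [← h0]
      apply Subgroup.card_dvd_of_le
      rintro _ ⟨a, ha, rfl⟩
      have ha : a ^ p = 1 := ha
      rw [MonoidHom.mem_ker, h, ha]
    have h2 := Subgroup.card_mul_index N.ker
    rw [Subgroup.index_ker, MonoidHom.range_eq_top.mpr hN, Subgroup.card_top] at h2
    rw [← h2, mul_comm]
    exact Nat.mul_dvd_mul_right h1 _

end HypE
end

section
open Polynomial nonZeroDivisors

set_option linter.all false

namespace HypE

/-- the ring -/
abbrev RR {F : Type*} [Field F] (f : F[X]) : Type _ := AdjoinRoot (X ^ 2 - C f : (F[X])[X])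

lemma hr {F : Type*} [Field F] (f : F[X]) (sqf : Squarefree f) (odd : Odd f.natDegree) (two : (2 : F) ≠ 0) :
    HR f (R := RR f) (AdjoinRoot.root (X ^ 2 - C f : (F[X])[X])) := by
  have hmon : (X ^ 2 - C f : (F[X])[X]).Monic := monic_X_pow_sub_C f two_ne_zero
  have hdeg : (X ^ 2 - C f : (F[X])[X]).degree = 2 := degree_X_pow_sub_C (by norm_num) f
  refine ⟨?_, ?_, ?_, sqf, odd, two⟩
  · have h := AdjoinRoot.eval₂_root (X ^ 2 - C f : (F[X])[X])
    rw [eval₂_sub, eval₂_pow, eval₂_X, eval₂_C, sub_eq_zero] at h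
    exact h
  · intro z
    obtain ⟨g, rfl⟩ := AdjoinRoot.mk_surjective z
    have h1 : (g %ₘ (X ^ 2 - C f)).degree ≤ 1 := by
      have := degree_modByMonic_lt g hmon
      rw [hdeg] at this
      exact Order.le_of_lt_succ this
    obtain ⟨a, b, hab⟩ : ∃ a b, g %ₘ (X ^ 2 - C f) = C a * X + C b := ⟨_, _, eq_X_add_C_of_degree_le_one h1⟩
    refine ⟨(b, a), ?_⟩
    have h2 : AdjoinRoot.mk (X ^ 2 - C f) g = AdjoinRoot.mk (X ^ 2 - C f) (g %ₘ (X ^ 2 - C f)) := by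
      conv_lhs => rw [← modByMonic_add_div g (X ^ 2 - C f)]
      simp
    rw [h2, hab, map_add, map_mul, AdjoinRoot.mk_C, AdjoinRoot.mk_C, AdjoinRoot.mk_X, add_comm]
    rfl
  · intro a b h
    have h2 : AdjoinRoot.mk (X ^ 2 - C f) (C b * X + C a) = 0 := by
      rw [map_add, map_mul, AdjoinRoot.mk_C, AdjoinRoot.mk_C, AdjoinRoot.mk_X, add_comm]
      exact h
    rw [AdjoinRoot.mk_eq_zero] at h2
    have h3 := eq_zero_of_dvd_of_degree_lt h2 (by
      rw [hdeg]
      exact lt_of_le_of_lt degree_linear_le (by norm_num))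
    constructor
    · have := congrArg (fun g => coeff g 0) h3
      simpa using this
    · have := congrArg (fun g => coeff g 1) h3
      simpa using this

section
variable {F L : Type*} [Field F] [Field L] [Algebra F L] (f : F[X]) (f' : L[X]) (hf : f' = f.map (algebraMap F L))

include hf in
lemma hom_ok : eval₂ ((AdjoinRoot.of (X ^ 2 - C f' : (L[X])[X])).comp (mapRingHom (algebraMap F L)))
    (AdjoinRoot.root (X ^ 2 - C f' : (L[X])[X])) (X ^ 2 - C f) = 0 := by
  have h := AdjoinRoot.eval₂_root (X ^ 2 - C f' : (L[X])[X])
  rw [eval₂_sub, eval₂_pow, eval₂_X, eval₂_C] at h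
  rw [eval₂_sub, eval₂_pow, eval₂_X, eval₂_C, RingHom.comp_apply, coe_mapRingHom, ← hf]
  exact h

/-- base change map -/
noncomputable def bc : RR f →+* RR f' := AdjoinRoot.lift _ _ (hom_ok f f' hf)

include hf in
theorem step [Finite F] [Finite L] (sqf : Squarefree f) (sqf' : Squarefree f') (odd : Odd f.natDegree)
    (two : (2 : F) ≠ 0) [IsDomain (RR f)] [IsDomain (RR f')] (p : ℕ) (hp : p.Prime) (hfr : Module.finrank F L = p) :
    Nat.card (powMonoidHom p : ClassGroup (RR f) →* ClassGroup (RR f)).ker ∣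
      Nat.card (powMonoidHom p : ClassGroup (RR f') →* ClassGroup (RR f')).ker ∧
    Nat.card (ClassGroup (RR f)) * Nat.card (powMonoidHom p : ClassGroup (RR f) →* ClassGroup (RR f)).ker ∣
      Nat.card (ClassGroup (RR f')) := by
  have H := hr f sqf odd two
  have two' : (2 : L) ≠ 0 := by
    have h2 : algebraMap F L 2 ≠ 0 := (_root_.map_ne_zero _).mpr two
    rwa [map_ofNat] at h2
  have H' := hr f' sqf' (by rw [hf, natDegree_map]; exact odd) two'
  letI : Algebra (RR f) (RR f') := (bc f f' hf).toAlgebra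
  have T : Tower H H' := ⟨hf, AdjoinRoot.lift_root (hom_ok f f' hf), fun a => by
    exact AdjoinRoot.lift_of (hom_ok f f' hf)⟩
  haveI := H.dedekind
  haveI := H'.dedekind
  haveI := T.mfin
  haveI := T.tf
  haveI := H.finite_class
  haveI := H'.finite_class
  refine group_step p (ClassGroup.extendedHom (RR f) (RR f')) (Ncl (RR f) (RR f')) T.ext_inj (T.N_surj (by rwa [hfr])) ?_
  intro a
  rw [Ncl_ext, T.finrank, hfr]

end

lemma finite_cl {F : Type*} [Field F] [Finite F] (f : F[X]) (sqf : Squarefree f) (odd : Odd f.natDegree) (two : (2 : F) ≠ 0)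
    [IsDomain (RR f)] : Finite (ClassGroup (RR f)) := by
  have H := hr f sqf odd two
  haveI := H.dedekind
  exact H.finite_class

theorem upper {F : Type*} [Field F] [Finite F] (f : F[X]) (sqf : Squarefree f) (odd : Odd f.natDegree) (two : (2 : F) ≠ 0)
    [IsDomain (RR f)] (p : ℕ) (hp : p.Prime) (hp2 : 3 ≤ p)
    (L : ℕ → Type*) [∀ n, Field (L n)] [∀ n, Finite (L n)] [∀ n, Algebra F (L n)]
    (hL : ∀ n, Module.finrank F (L n) = p ^ n) (f' : ∀ n, (L n)[X]) (hf : ∀ n, f' n = f.map (algebraMap F (L n)))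
    (sqf' : ∀ n, Squarefree (f' n)) [∀ n, IsDomain (RR (f' n))] :
    ∃ B D : ℕ, ∀ n, (Nat.card (ClassGroup (RR (f' n)))).factorization p ≤ B + D * n := by
  haveI : Fact p.Prime := ⟨hp⟩
  have H := hr f sqf odd two
  haveI := H.dedekind
  obtain ⟨P, hP0, hP1, -, hLD⟩ := H.exists_P (Fo := PadicAlgCl p)
  obtain ⟨s, hs, hpow⟩ := pow_transfer P hP0 _ hLD
  have two' : ∀ n, (2 : L n) ≠ 0 := by
    intro n
    have h2 : algebraMap F (L n) 2 ≠ 0 := (_root_.map_ne_zero _).mpr two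
    rwa [map_ofNat] at h2
  have odd' : ∀ n, Odd (f' n).natDegree := fun n => by rw [hf, natDegree_map]; exact odd
  refine factorization_bound hp2 s (fun n => Nat.card (ClassGroup (RR (f' n)))) ?_ ?_
  · intro n
    have := finite_cl (f' n) (sqf' n) (odd' n) (two' n)
    exact Nat.card_pos.ne'
  · intro n
    have H' := hr (f' n) (sqf' n) (odd' n) (two' n)
    haveI := H'.dedekind
    obtain ⟨Q, hQ0, hQ1, -, hLD'⟩ := H'.exists_P (Fo := PadicAlgCl p)
    have h1 := hpow (p ^ n) (pow_pos hp.pos n) (Q : PowerSeries (PadicAlgCl p)) _ hLD'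
      (by rw [Polynomial.coeff_coe, hQ0]) (by
        intro m hm
        rw [H.aX_one, H'.aX_one, H.vM_transfer (hf n) H' m hm, hL, Module.natCard_eq_pow_finrank (K := F) (V := L n), hL,
          pow_mul]
        push_cast; rfl)
    have h2 := Polynomial.coe_injective _ h1
    rw [← hQ1, h2, eval_multiset_prod, Multiset.map_map]
    simp

end HypE
end

section
open Polynomial


namespace HypE

lemma finrank_of_card {A B : Type*} [Field A] [Field B] [Fintype A] [Fintype B] [Algebra A B] {c d : ℕ}
    (hA : Fintype.card A = c) (hB : Fintype.card B = c ^ d) : Module.finrank A B = d := by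
  have h := Module.card_eq_pow_finrank (K := A) (V := B)
  rw [hA, hB] at h
  have hc : 1 < c := by rw [← hA]; exact Fintype.one_lt_card
  exact (Nat.pow_right_injective hc h).symm

lemma two_ne {A : Type*} [Field A] [Fintype A] (h : Odd (Fintype.card A)) : (2 : A) ≠ 0 := by
  intro h2
  have h3 : ringChar A ≠ 2 := by
    intro h4
    have := FiniteField.even_card_of_char_two h4
    rw [Nat.odd_iff] at h
    omega
  exact Ring.two_ne_zero h3 h2

theorem lower {p q : ℕ} (hp : p.Prime) (hqodd : Odd q)
    {k : Type*} [Field k] [Fintype k] (hk : Fintype.card k = q)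
    (K : ℕ → Type*) [∀ n, Field (K n)] [∀ n, Fintype (K n)]
    (hK : ∀ n, Fintype.card (K n) = q ^ p ^ n)
    (ι : ∀ n, k →+* K n)
    (f : k[X]) (hf : Squarefree f) (hdeg : Odd f.natDegree)
    [∀ n, IsDomain (RR (f.map (ι n)))] (hp3 : 3 ≤ p) (r : ℕ)
    (hr : Nat.card (ClassGroup (RR (f.map (ι 0))) ⧸
      (powMonoidHom p : ClassGroup (RR (f.map (ι 0))) →* ClassGroup (RR (f.map (ι 0)))).range) = p ^ r) :
    (∀ n, r * n ≤ (Nat.card (ClassGroup (RR (f.map (ι n))))).factorization p) ∧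
    ∃ B D : ℕ, ∀ n, (Nat.card (ClassGroup (RR (f.map (ι n))))).factorization p ≤ B + D * n := by
  have sq : ∀ n, Squarefree (f.map (ι n)) := fun n =>
    (((PerfectField.separable_iff_squarefree (K := k)).mpr hf).map).squarefree
  have two : ∀ n, (2 : K n) ≠ 0 := fun n => two_ne (by rw [hK]; exact hqodd.pow)
  have odd : ∀ n, Odd (f.map (ι n)).natDegree := fun n => by rwa [natDegree_map]
  have fin : ∀ n, Finite (ClassGroup (RR (f.map (ι n)))) := fun n => finite_cl _ (sq n) (odd n) (two n)
  have hom : ∀ n m, n ≤ m → ∃ τ : K n →+* K m, τ.comp (ι n) = ι m := by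
    intro n m hnm
    letI := (ι n).toAlgebra
    letI := (ι m).toAlgebra
    obtain ⟨τ⟩ := FiniteField.nonempty_algHom_of_finrank_dvd (F := k) (K := K n) (L := K m) (by
      rw [finrank_of_card hk (hK n), finrank_of_card hk (hK m)]
      exact pow_dvd_pow p hnm)
    exact ⟨τ.toRingHom, τ.comp_algebraMap⟩
  have fr : ∀ n m (hA : Algebra (K n) (K (n + m))), Module.finrank (K n) (K (n + m)) = p ^ m := by
    intro n m hA
    refine finrank_of_card (hK n) ?_
    rw [hK, pow_add, pow_mul]
  have hstep : ∀ n, Nat.card (powMonoidHom p : ClassGroup (RR (f.map (ι n))) →* ClassGroup (RR (f.map (ι n)))).ker ∣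
      Nat.card (powMonoidHom p : ClassGroup (RR (f.map (ι (n+1)))) →* ClassGroup (RR (f.map (ι (n+1))))).ker ∧
    Nat.card (ClassGroup (RR (f.map (ι n)))) * Nat.card (powMonoidHom p : ClassGroup (RR (f.map (ι n))) →* ClassGroup (RR (f.map (ι n)))).ker ∣
      Nat.card (ClassGroup (RR (f.map (ι (n+1))))) := by
    intro n
    obtain ⟨τ, hτ⟩ := hom n (n+1) (Nat.le_succ n)
    letI := τ.toAlgebra
    exact step (f.map (ι n)) (f.map (ι (n+1))) (by rw [map_map, ← hτ]; rfl) (sq n) (sq (n+1)) (odd n) (two n) p hp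
      (by rw [fr n 1, pow_one])
  constructor
  · have h1 : ∀ n, p ^ r ∣ Nat.card (powMonoidHom p : ClassGroup (RR (f.map (ι n))) →* ClassGroup (RR (f.map (ι n)))).ker := by
      intro n
      induction n with
      | zero =>
        haveI := fin 0
        rw [card_tors, hr]
      | succ n ih => exact ih.trans (hstep n).1
    have h2 : ∀ n, p ^ (r * n) ∣ Nat.card (ClassGroup (RR (f.map (ι n)))) := by
      intro n
      induction n with
      | zero => simp
      | succ n ih =>
        rw [Nat.mul_succ, pow_add]
        exact (mul_dvd_mul ih (h1 n)).trans (hstep n).2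
    intro n
    haveI := fin n
    exact (hp.pow_dvd_iff_le_factorization Nat.card_pos.ne').mp (h2 n)
  · choose τ hτ using fun n => hom 0 n (Nat.zero_le n)
    letI : ∀ n, Algebra (K 0) (K n) := fun n => (τ n).toAlgebra
    exact upper (f.map (ι 0)) (sq 0) (odd 0) (two 0) p hp hp3 K (fun n => by
      refine finrank_of_card (hK 0) ?_
      rw [hK, pow_zero, pow_one]) (fun n => f.map (ι n)) (fun n => by rw [map_map]; exact congrArg (fun t => f.map t) (hτ n).symm) sq
end HypE
end

/-- **λ ≥ p-rank.**
With `R n = 𝔽_{q^{p^n}}[T][x]/(x² - f)` for `f ∈ 𝔽_q[T]` squarefree of odd degree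
and `e n = v_p(#Cl(R n))`, we have
`liminf_n e n / n ≥ dim_{𝔽_p}(Cl(R 0)/p·Cl(R 0))`, the `𝔽_p`-dimension `r` being
characterized by `#(Cl(R 0)/Cl(R 0)^p) = p ^ r`. -/
theorem liminf_en_div_n_ge_p_rank
    {p : ℕ} (hp : p.Prime) (hpodd : Odd p)
    {q : ℕ} (hq : IsPrimePow q) (hqodd : Odd q)
    {k : Type*} [Field k] [Fintype k] (hk : Fintype.card k = q)
    (K : ℕ → Type*) [∀ n, Field (K n)] [∀ n, Fintype (K n)]
    (hK : ∀ n, Fintype.card (K n) = q ^ p ^ n)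
    (ι : ∀ n, k →+* K n)
    (f : k[X]) (hf : Squarefree f) (hdeg : Odd f.natDegree)
    [∀ n, IsDomain (AdjoinRoot (X ^ 2 - C (f.map (ι n)) : ((K n)[X])[X]))] :
    ∀ r : ℕ,
      Nat.card (ClassGroup (AdjoinRoot (X ^ 2 - C (f.map (ι 0)) : ((K 0)[X])[X])) ⧸
          (powMonoidHom p :
            ClassGroup (AdjoinRoot (X ^ 2 - C (f.map (ι 0)) : ((K 0)[X])[X])) →*
            ClassGroup (AdjoinRoot (X ^ 2 - C (f.map (ι 0)) : ((K 0)[X])[X]))).range)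
        = p ^ r →
      (r : ℝ) ≤ Filter.liminf (fun n : ℕ =>
        ((Nat.card (ClassGroup
            (AdjoinRoot (X ^ 2 - C (f.map (ι n)) : ((K n)[X])[X])))).factorization p : ℝ) / n)
        Filter.atTop := by
  intro r hr
  have hp3 : 3 ≤ p := by
    have := hp.two_le
    rcases hpodd with ⟨m, hm⟩
    omega
  obtain ⟨h1, B, D, h2⟩ := HypE.lower hp hqodd hk K hK ι f hf hdeg hp3 r hr
  refine Filter.le_liminf_of_le ?_ ?_
  · refine Filter.IsBoundedUnder.isCoboundedUnder_ge ?_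
    refine Filter.isBoundedUnder_of_eventually_le (a := (B : ℝ) + D) ?_
    filter_upwards [Filter.eventually_ge_atTop 1] with n hn
    have hn' : (1 : ℝ) ≤ n := by exact_mod_cast hn
    rw [div_le_iff₀ (by linarith)]
    have h3 : ((Nat.card (ClassGroup
            (AdjoinRoot (X ^ 2 - C (f.map (ι n)) : ((K n)[X])[X])))).factorization p : ℝ) ≤ B + D * n := by
      exact_mod_cast h2 n
    have hB : (0 : ℝ) ≤ B := Nat.cast_nonneg B
    nlinarith
  · filter_upwards [Filter.eventually_ge_atTop 1] with n hn
    have hn' : (1 : ℝ) ≤ n := by exact_mod_cast hn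
    rw [le_div_iff₀ (by linarith)]
    exact_mod_cast h1 n
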